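/- Let ℓ ≥ 1 and 0 ≤ m ≤ ℓ. Then the sum over all strict partitions μ in F_1^m(Λ_ℓ) of δ̄_3(μ)·S_{μ^b[1]} equals ε(ℓ,m)·(p_2 ∘ S_{□(ℓ−m,m)}), where ε(ℓ,m) = (−1)^{C(m,2)} if 0 ≤ m ≤ ℓ/2 and ε(ℓ,m) = (−1)^{C(ℓ−m+1,2)+(ℓ−m)m} if ℓ/2 ≤ m ≤ ℓ. -/

import Mathlib

open scoped BigOperators

/-- A partition, represented canonically as the multiset of its (positive) parts. -/
structure Ptn where
  parts : Multiset ℕ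
  pos : ∀ x ∈ parts, 0 < x

namespace Ptn

/-- Build a partition from an arbitrary multiset of naturals by discarding zero parts. -/
def of (s : Multiset ℕ) : Ptn :=
  ⟨s.filter (fun x => 0 < x), fun _ hx => (Multiset.mem_filter.mp hx).2⟩

/-- The empty partition. -/
def empty : Ptn := ⟨0, by simp⟩

/-- The `i`-th largest part (`0`-indexed); `0` if `i` is at least the number of parts. -/
def part (l : Ptn) (i : ℕ) : ℕ :=
  ((l.parts.sort (· ≤ ·)).reverse).getD i 0

/-- The number of (positive) parts. -/
def length (l : Ptn) : ℕ := Multiset.card l.parts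

/-- The size `|λ|`, i.e. the number being partitioned. -/
def size (l : Ptn) : ℕ := l.parts.sum

/-- A partition is strict if all its parts are distinct. -/
def Strict (l : Ptn) : Prop := l.parts.Nodup

/-- The conjugate partition. -/
def conj (l : Ptn) : Ptn :=
  of ((Multiset.range (l.part 0)).map
    (fun j => Multiset.card (l.parts.filter (fun x => j < x))))

end Ptn

/-- The rectangular partition `□(n,m)` with `n` rows of length `m`. -/
def rect (n m : ℕ) : Ptn := Ptn.of (Multiset.replicate n m)

/-- The partition obtained by multiplying every part by `r`. -/
def scaleP (r : ℕ) (l : Ptn) : Ptn := Ptn.of (l.parts.map (fun a => r * a))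

/-- Diagram containment: every part of `small` is at most the corresponding part of `big`. -/
def Contains (big small : Ptn) : Prop := ∀ i, small.part i ≤ big.part i

/-- The beta-set (first-column hook lengths) `{λ_i + m - 1 - i : i < m}` of `l`,
computed with `m` beads (`m` at least the number of parts). -/
def betaSet (l : Ptn) (m : ℕ) : Finset ℕ :=
  (Finset.range m).image (fun i => l.part i + (m - 1 - i))

/-- The partition encoded by a finite set of bead positions: each bead contributes a part
equal to the number of empty positions (holes) below it. -/
def ptnOfBeads (B : Finset ℕ) : Ptn :=
  Ptn.of (B.val.map (fun p => p - (B.filter (fun q => q < p)).card))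

/-- Levels of the beads on runner `k` of the `r`-abacus of `l`,
drawn with `r * l.length` beads (a multiple of `r`). -/
def runnerLevels (r : ℕ) (l : Ptn) (k : ℕ) : Finset ℕ :=
  (Finset.range (l.part 0 + r * l.length + 1)).filter
    (fun s => r * s + k ∈ betaSet l (r * l.length))

/-- The `k`-th component `λ[k]` of the `r`-quotient of `l`. -/
def quotP (r : ℕ) (l : Ptn) (k : ℕ) : Ptn := ptnOfBeads (runnerLevels r l k)

/-- The `r`-core of `l`: push all beads of the `r`-abacus down as far as possible. -/
def coreP (r : ℕ) (l : Ptn) : Ptn :=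
  ptnOfBeads ((Finset.range r).biUnion
    (fun k => (Finset.range (runnerLevels r l k).card).image (fun s => r * s + k)))

/-- The key of the bead at position `p` for the `r`-numbering of the beads `B`:
a bead which is the `j`-th lowest bead on runner `k` gets key `r * j + k`. -/
def rKey (r : ℕ) (B : Finset ℕ) (p : ℕ) : ℕ :=
  r * (B.filter (fun q => q % r = p % r ∧ q < p)).card + p % r

/-- The number of inversions between the natural (increasing-position) numbering of the
beads `B` and the numbering by increasing `key`. -/
def inversions (key : ℕ → ℕ) (B : Finset ℕ) : ℕ :=
  ((B ×ˢ B).filter (fun pq => pq.1 < pq.2 ∧ key pq.2 < key pq.1)).card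

/-- Exponent of the `r`-sign `δ_r`. -/
def rSignExp (r : ℕ) (l : Ptn) : ℕ :=
  inversions (rKey r (betaSet l (r * l.length))) (betaSet l (r * l.length))

/-- The `r`-sign `δ_r(λ) ∈ {±1}`. -/
def rSign (r : ℕ) (l : Ptn) : ℤ := (-1) ^ rSignExp r l

/-- The key of the bead at position `p` for the `3`-bar numbering of the beads `B` of the
`3`-bar abacus: first the beads of runner `0` in increasing order, then the pairs of beads
on runners `2` and `1` paired off by increasing level (runner-`2` bead before
runner-`1` bead), then the remaining unpaired beads in increasing order. -/
def barKey (B : Finset ℕ) (p : ℕ) : ℕ :=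
  let n0 := (B.filter (fun q => q % 3 = 0)).card
  let t := min ((B.filter (fun q => q % 3 = 1)).card)
              ((B.filter (fun q => q % 3 = 2)).card)
  let rk := (B.filter (fun q => q % 3 = p % 3 ∧ q < p)).card
  if p % 3 = 0 then rk
  else if rk < t then (if p % 3 = 2 then n0 + 2 * rk else n0 + 2 * rk + 1)
  else n0 + 2 * t + (rk - t)

/-- Exponent of the `3`-bar sign `δ̄_3`.  The beads of the `3`-bar abacus of a strict
partition sit at the positions given by the parts. -/
def barSignExp (l : Ptn) : ℕ :=
  inversions (barKey l.parts.toFinset) l.parts.toFinset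

/-- The `3`-bar sign `δ̄_3(λ) ∈ {±1}` of a strict partition. -/
def barSign3 (l : Ptn) : ℤ := (-1) ^ barSignExp l

/-- The double `D(λ) = (λ_1,…,λ_l | λ_1 - 1,…,λ_l - 1)` (Frobenius notation)
of a strict partition `λ`, constructed row by row. -/
noncomputable def double (l : Ptn) : Ptn :=
  Ptn.of ((Multiset.range (l.length + l.part 0)).map (fun i =>
    (if i < l.length then l.part i + 1 else 0) +
      ((Finset.range (min i l.length)).filter (fun j => i + 1 ≤ j + l.part j)).card))

/-- The second component `λ^b[1] = D(λ)[1]` of the `3`-bar quotient of a strict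
partition `λ`. -/
noncomputable def barQuot1 (l : Ptn) : Ptn := quotP 3 (double l) 1

/-- The staircase-like strict partition `Λ_ℓ = (3ℓ-2, 3ℓ-5, …, 7, 4, 1)`. -/
def LamP (ℓ : ℕ) : Ptn := Ptn.of ((Multiset.range ℓ).map (fun i => 3 * i + 1))

/-- The staircase partition `Δ_ℓ = (ℓ, ℓ-1, …, 1)`. -/
def DelP (ℓ : ℕ) : Ptn := Ptn.of (Multiset.range (ℓ + 1))

/-- `F_1^m(Λ_ℓ)`: strict partitions obtained from `Λ_ℓ` by adding `m` cells, each
labelled `1`, where the cell in (0-indexed) column `j` is labelled `1` iff `j % 3 = 1`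
(each row reads `0,1,0,0,1,0,…`). -/
def F1Lam (ℓ m : ℕ) : Set Ptn :=
  {mu | mu.Strict ∧ Contains mu (LamP ℓ) ∧ mu.size = (LamP ℓ).size + m ∧
    ∀ i j, (LamP ℓ).part i ≤ j → j < mu.part i → j % 3 = 1}

/-- `F_1^m(Δ_ℓ)`: partitions obtained from `Δ_ℓ` by adding `m` cells, each labelled `1`,
where the cell `(i,j)` is labelled `1` iff `i + j` is odd. -/
def F1Del (ℓ m : ℕ) : Set Ptn :=
  {mu | Contains mu (DelP ℓ) ∧ mu.size = (DelP ℓ).size + m ∧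
    ∀ i j, (DelP ℓ).part i ≤ j → j < mu.part i → (i + j) % 2 = 1}

/-- `(α, β)` is complementary relative to the rectangle `□(n,m)`:
`α ⊆ □(n,m)` and `β_i = m - α_{n+1-i}` for `1 ≤ i ≤ n` (0-indexed below). -/
def Complementary (n m : ℕ) (a b : Ptn) : Prop :=
  a.length ≤ n ∧ a.part 0 ≤ m ∧ b.length ≤ n ∧
    ∀ i < n, b.part i = m - a.part (n - 1 - i)

/-- `W(n,m)`: the set of `(n,m)`-balanced partitions, i.e. partitions of `2nm` with at
most `2n` parts satisfying `μ_i + μ_{2n+1-i} = 2m` for `1 ≤ i ≤ n` (0-indexed below). -/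
def W (n m : ℕ) : Set Ptn :=
  {mu | mu.size = 2 * n * m ∧ mu.length ≤ 2 * n ∧
    ∀ i < n, mu.part i + mu.part (2 * n - 1 - i) = 2 * m}

/-! ### The ring of symmetric functions

We realise the ring of symmetric functions (with rational coefficients) as the
polynomial ring `ℚ[p_1, p_2, …]` in the power sums: the variable `X n` of
`MvPolynomial ℕ ℚ` stands for the power sum `p_{n+1}`. -/

abbrev SymF := MvPolynomial ℕ ℚ

open MvPolynomial

/-- `z_ρ = ∏ a^{m_a} m_a!` for a partition given as a multiset `ρ`. -/
def zval (s : Multiset ℕ) : ℚ :=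
  s.toFinset.prod (fun a => (a : ℚ) ^ s.count a * (Nat.factorial (s.count a) : ℚ))

/-- The power sum product `p_ρ` of a multiset `ρ`. -/
noncomputable def pMult (s : Multiset ℕ) : SymF :=
  (s.map (fun a => (X (a - 1) : SymF))).prod

/-- The complete homogeneous symmetric function `h_n = Σ_{ρ ⊢ n} z_ρ⁻¹ p_ρ`. -/
noncomputable def hSym (n : ℕ) : SymF :=
  ∑ ρ : Nat.Partition n, (zval ρ.parts)⁻¹ • pMult ρ.parts

/-- `h_k` for an integer index, vanishing for negative `k`. -/
noncomputable def hz (k : ℤ) : SymF := if k < 0 then 0 else hSym k.toNat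

/-- The Schur function `S_λ`, via the Jacobi–Trudi formula
`S_λ = det(h_{λ_i - i + j})`. -/
noncomputable def schur (l : Ptn) : SymF :=
  Matrix.det (Matrix.of (fun i j : Fin l.length =>
    hz ((l.part i.val : ℤ) + (j.val : ℤ) - (i.val : ℤ))))

/-- The plethysm `p_r ∘ f`: the algebra endomorphism sending each power sum `p_k`
to `p_{rk}`, i.e. substituting `x_i^r` for each variable `x_i`. -/
noncomputable def pleth (r : ℕ) (f : SymF) : SymF :=
  MvPolynomial.aeval (fun n => (X (r * (n + 1) - 1) : SymF)) f

/-- The `z`-weight of a power-sum monomial (exponent vector `d`). -/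
def zfac (d : ℕ →₀ ℕ) : ℚ :=
  d.prod (fun i e => ((i : ℚ) + 1) ^ e * (Nat.factorial e : ℚ))

/-- The Hall inner product, for which `⟨p_ρ, p_σ⟩ = δ_{ρσ} z_ρ` and the Schur
functions are orthonormal. -/
noncomputable def hall (f g : SymF) : ℚ :=
  f.support.sum (fun d => f.coeff d * g.coeff d * zfac d)

/-- The multi-Littlewood–Richardson coefficient `LR^λ_{μ^0,…,μ^{r-1}}`:
the multiplicity of `S_λ` in `S_{μ^0} ⋯ S_{μ^{r-1}}`. -/
noncomputable def LRmulti (lam : Ptn) (r : ℕ) (q : ℕ → Ptn) : ℚ :=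
  hall ((Finset.range r).prod (fun k => schur (q k))) (schur lam)

/-- The Littlewood–Richardson coefficient `LR^λ_{α,β}`:
the multiplicity of `S_λ` in `S_α · S_β`. -/
noncomputable def LR2 (lam a b : Ptn) : ℚ := hall (schur a * schur b) (schur lam)

/-- The irreducible symmetric group character `χ^μ(ρ)`, via the Frobenius formula
`χ^μ_ρ = ⟨S_μ, p_ρ⟩`. -/
noncomputable def chi (mu rho : Ptn) : ℚ := hall (schur mu) (pMult rho.parts)

/-- Symmetric functions in two alphabets `u`, `v`: `X (inl n)` is `p_{n+1}(u)` and
`X (inr n)` is `p_{n+1}(v)`. -/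
abbrev SymF2 := MvPolynomial (ℕ ⊕ ℕ) ℚ

/-- `f ↦ f(u)`. -/
noncomputable def toU : SymF →ₐ[ℚ] SymF2 :=
  aeval (fun n => (X (Sum.inl n) : SymF2))

/-- `f ↦ f(v)`. -/
noncomputable def toV : SymF →ₐ[ℚ] SymF2 :=
  aeval (fun n => (X (Sum.inr n) : SymF2))

/-- `f ↦ f(u - v)`, the difference of alphabets: `p_k ↦ p_k(u) - p_k(v)`. -/
noncomputable def toUV : SymF →ₐ[ℚ] SymF2 :=
  aeval (fun n => (X (Sum.inl n) : SymF2) - X (Sum.inr n))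

namespace Ptn

theorem ext_parts {l l' : Ptn} (h : l.parts = l'.parts) : l = l' := by
  cases l; cases l'; simp_all

theorem part_of_length_le (l : Ptn) {i : ℕ} (h : l.length ≤ i) : l.part i = 0 := by
  unfold part
  rw [List.getD_eq_default]
  simpa [length] using h

theorem part_eq_getElem (l : Ptn) {i : ℕ} (h : i < (l.parts.sort (· ≤ ·)).reverse.length) :
    l.part i = (l.parts.sort (· ≤ ·)).reverse[i] := by
  unfold part
  rw [List.getD_eq_getElem]

theorem part_mem (l : Ptn) {i : ℕ} (h : i < l.length) : l.part i ∈ l.parts := by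
  have h' : i < (l.parts.sort (· ≤ ·)).reverse.length := by simpa [length] using h
  rw [part_eq_getElem l h']
  exact (Multiset.mem_sort (· ≤ ·)).mp (List.mem_reverse.mp (List.getElem_mem h'))

theorem part_pos_iff (l : Ptn) {i : ℕ} : 0 < l.part i ↔ i < l.length := by
  constructor
  · intro h
    by_contra hc
    rw [part_of_length_le l (not_lt.mp hc)] at h
    exact lt_irrefl _ h
  · intro h
    exact l.pos _ (l.part_mem h)

theorem pairwise_reverse_sort (l : Ptn) :
    (l.parts.sort (· ≤ ·)).reverse.Pairwise (· ≥ ·) := by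
  rw [List.pairwise_reverse]
  exact Multiset.pairwise_sort l.parts (· ≤ ·)

theorem part_antitone (l : Ptn) : Antitone l.part := by
  intro i j hij
  rcases hij.eq_or_lt with rfl | hlt
  · exact le_rfl
  by_cases hj : j < l.length
  · have hj' : j < (l.parts.sort (· ≤ ·)).reverse.length := by simpa [length] using hj
    rw [part_eq_getElem l hj', part_eq_getElem l (hlt.trans hj')]
    exact List.pairwise_iff_getElem.mp l.pairwise_reverse_sort i j _ hj' hlt
  · rw [part_of_length_le l (not_lt.mp hj)]
    exact Nat.zero_le _

theorem parts_eq_map_part (l : Ptn) : l.parts = (Multiset.range l.length).map l.part := by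
  have h1 : (l.parts.sort (· ≤ ·)).reverse = (List.range l.length).map l.part := by
    apply List.ext_getElem
    · simp [length]
    · intro i h h'
      rw [← part_eq_getElem l h]
      simp
  have h2 : ((l.parts.sort (· ≤ ·)).reverse : Multiset ℕ) = l.parts := by
    rw [Multiset.coe_reverse, Multiset.sort_eq]
  rw [← h2, h1]
  rfl

theorem ext_part {l l' : Ptn} (h : ∀ i, l.part i = l'.part i) : l = l' := by
  have hlen : l.length = l'.length := by
    apply eq_of_forall_lt_iff
    intro i
    rw [← part_pos_iff, ← part_pos_iff, h]
  apply ext_parts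
  rw [parts_eq_map_part l, parts_eq_map_part l', hlen]
  exact Multiset.map_congr rfl fun i _ => h i

/-- A weakly decreasing sequence vanishing from `N` on is the sequence of parts of the
partition it defines. -/
theorem part_of_map_range {f : ℕ → ℕ} (hf : Antitone f) {N : ℕ} (h0 : ∀ i, N ≤ i → f i = 0)
    (i : ℕ) : (of ((Multiset.range N).map f)).part i = f i := by
  have hex : ∃ i, f i = 0 := ⟨N, h0 N le_rfl⟩
  obtain ⟨K, hK⟩ : ∃ K, ∀ i, 0 < f i ↔ i < K := by
    refine ⟨Nat.find hex, fun i => ⟨fun h => ?_, fun h => ?_⟩⟩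
    · by_contra hc
      have := hf (not_lt.mp hc)
      rw [Nat.find_spec hex] at this
      omega
    · exact Nat.pos_of_ne_zero (Nat.find_min hex h)
  have hparts : (of ((Multiset.range N).map f)).parts = (((List.range K).map f : List ℕ) :
      Multiset ℕ) := by
    have h1 : Multiset.filter (fun i => 0 < f i) (Multiset.range N) = Multiset.range K := by
      refine Multiset.Nodup.ext ((Multiset.nodup_range N).filter _) (Multiset.nodup_range K) |>.mpr
        fun i => ?_
      rw [Multiset.mem_filter, Multiset.mem_range, Multiset.mem_range, hK]
      refine ⟨fun h => h.2, fun h => ⟨?_, h⟩⟩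
      by_contra hc
      have := (hK i).mpr h
      rw [h0 i (not_lt.mp hc)] at this
      exact lt_irrefl _ this
    change Multiset.filter (fun x => 0 < x) ((Multiset.range N).map f) = _
    rw [Multiset.filter_map]
    change Multiset.map f (Multiset.filter (fun i => 0 < f i) (Multiset.range N)) = _
    rw [h1]
    rfl
  have hlist : ((of ((Multiset.range N).map f)).parts.sort (· ≤ ·)).reverse
      = (List.range K).map f := by
    apply List.Perm.eq_of_pairwise' (pairwise_reverse_sort _)
    · rw [List.pairwise_map]
      exact List.pairwise_lt_range.imp fun h => hf h.le
    · rw [← Multiset.coe_eq_coe, Multiset.coe_reverse, Multiset.sort_eq, hparts]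
  unfold part
  rw [hlist]
  by_cases h : i < K
  · rw [List.getD_eq_getElem _ _ (by simpa using h)]
    simp
  · rw [List.getD_eq_default _ _ (by simpa using h)]
    have := (hK i).not.mpr h
    omega

theorem length_of_map_range_le (f : ℕ → ℕ) (N : ℕ) :
    (of ((Multiset.range N).map f)).length ≤ N := by
  have h : (of ((Multiset.range N).map f)).parts ≤ (Multiset.range N).map f :=
    Multiset.filter_le _ _
  simpa [length] using Multiset.card_le_card h

end Ptn

theorem hSym_zero : hSym 0 = 1 := by
  unfold hSym
  rw [Fintype.sum_unique]
  have : (default : Nat.Partition 0).parts = 0 := by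
    simp
  rw [this]
  simp [zval, pMult]

theorem hz_zero : hz 0 = 1 := by simp [hz, hSym_zero]

theorem hz_of_neg {k : ℤ} (h : k < 0) : hz k = 0 := by simp [hz, h]

theorem hz_natCast (k : ℕ) : hz (k : ℤ) = hSym k := by simp [hz]

/-- The Jacobi–Trudi determinant may be computed with any number of rows that is at least the
number of parts. -/
theorem schur_eq_det_of_length_le (l : Ptn) {N : ℕ} (h : l.length ≤ N) :
    schur l = Matrix.det (Matrix.of (fun i j : Fin N =>
      hz ((l.part i.val : ℤ) + (j.val : ℤ) - (i.val : ℤ)))) := by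
  induction N, h using Nat.le_induction with
  | base => rfl
  | succ N hN ih =>
    rw [ih, Matrix.det_succ_row _ (Fin.last N), Fin.sum_univ_castSucc, Finset.sum_eq_zero, zero_add]
    · have : (Matrix.of (fun i j : Fin (N + 1) =>
          hz ((l.part i.val : ℤ) + (j.val : ℤ) - (i.val : ℤ)))) (Fin.last N) (Fin.last N) = 1 := by
        simp [l.part_of_length_le hN, hz_zero]
      rw [this]
      have hs : ((-1 : SymF)) ^ ((Fin.last N : ℕ) + (Fin.last N : ℕ)) = 1 := by
        rw [← two_mul, pow_mul]; simp
      rw [hs, one_mul, one_mul]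
      congr 1
      ext1 i j
      simp
    · intro j _
      have : (Matrix.of (fun i j : Fin (N + 1) =>
          hz ((l.part i.val : ℤ) + (j.val : ℤ) - (i.val : ℤ)))) (Fin.last N) j.castSucc = 0 := by
        simp only [Matrix.of_apply, Fin.val_last, Fin.val_castSucc, l.part_of_length_le hN]
        apply hz_of_neg
        have := j.isLt
        omega
      rw [this]
      simp

namespace Ptn

theorem mem_parts_iff (l : Ptn) {x : ℕ} : x ∈ l.parts ↔ ∃ i < l.length, l.part i = x := by
  conv_lhs => rw [parts_eq_map_part l]
  simp

theorem Strict.part_lt {l : Ptn} (hs : l.Strict) {i j : ℕ} (hij : i < j) (hj : j < l.length) :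
    l.part j < l.part i := by
  refine lt_of_le_of_ne (l.part_antitone hij.le) fun h => hij.ne' ?_
  unfold Strict at hs
  rw [parts_eq_map_part l] at hs
  exact Multiset.inj_on_of_nodup_map hs j (by simpa using hj) i (by simpa using hij.trans hj) h

theorem Strict.part_add_le {l : Ptn} (hs : l.Strict) {i j : ℕ} (hij : i ≤ j)
    (hj : j < l.length) : j + l.part j ≤ i + l.part i := by
  induction j, hij using Nat.le_induction with
  | base => exact le_rfl
  | succ j hij ih =>
    have h1 := ih (by omega)
    have h2 := hs.part_lt (Nat.lt_add_one j) hj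
    omega

end Ptn

/-- The rows of the double of a strict partition. -/
def doubleRow (l : Ptn) (i : ℕ) : ℕ :=
  if i < l.length then l.part i + 1 + i
  else ((Finset.range l.length).filter (fun j => i + 1 ≤ j + l.part j)).card

theorem doubleRow_le_length (l : Ptn) {i : ℕ} (h : l.length ≤ i) : doubleRow l i ≤ l.length := by
  rw [doubleRow, if_neg (not_lt.mpr h)]
  exact (Finset.card_filter_le _ _).trans (Finset.card_range _).le

theorem doubleRow_antitone {l : Ptn} (hs : l.Strict) : Antitone (doubleRow l) := by
  intro i k hik
  by_cases hk : k < l.length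
  · have := hs.part_add_le hik hk
    rw [doubleRow, doubleRow, if_pos hk, if_pos (by omega)]
    omega
  · by_cases hi : i < l.length
    · have h1 := doubleRow_le_length l (not_lt.mp hk)
      have h2 := hs.part_add_le (i := i) (j := l.length - 1) (by omega) (by omega)
      rw [doubleRow.eq_1 l i, if_pos hi]
      omega
    · rw [doubleRow, doubleRow, if_neg hk, if_neg hi]
      apply Finset.card_le_card
      intro j hj
      simp only [Finset.mem_filter] at hj ⊢
      exact ⟨hj.1, by omega⟩

theorem double_eq {l : Ptn} (hs : l.Strict) :
    double l = Ptn.of ((Multiset.range (l.length + l.part 0)).map (doubleRow l)) := by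
  unfold double
  congr 1
  apply Multiset.map_congr rfl
  intro i _
  unfold doubleRow
  by_cases hi : i < l.length
  · rw [if_pos hi, if_pos hi, min_eq_left hi.le, Finset.filter_true_of_mem, Finset.card_range]
    intro j hj
    have := hs.part_add_le (Finset.mem_range.mp hj).le hi
    have := l.part_pos_iff.mpr hi
    omega
  · rw [if_neg hi, if_neg hi, min_eq_right (not_lt.mp hi), zero_add]

theorem part_double {l : Ptn} (hs : l.Strict) (i : ℕ) : (double l).part i = doubleRow l i := by
  rw [double_eq hs]
  apply Ptn.part_of_map_range (doubleRow_antitone hs)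
  intro i hi
  rw [doubleRow, if_neg (by omega), Finset.card_eq_zero, Finset.filter_eq_empty_iff]
  intro j hj
  have := hs.part_add_le (Nat.zero_le j) (Finset.mem_range.mp hj)
  omega

theorem length_le_length_double {l : Ptn} (hs : l.Strict) : l.length ≤ (double l).length := by
  by_contra h
  push Not at h
  have := (double l).part_of_length_le le_rfl
  rw [part_double hs, doubleRow, if_pos h] at this
  omega

/-- The beads of the double of a strict partition, with `M` beads drawn, sit above `M` at the
parts, and below `M` at the reflections of the non-parts. -/
theorem mem_betaSet_double {l : Ptn} (hs : l.Strict) {M : ℕ} (hM : (double l).length ≤ M)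
    {x : ℕ} : x ∈ betaSet (double l) M ↔
      (M < x ∧ x - M ∈ l.parts) ∨ (x < M ∧ M - x ∉ l.parts) := by
  have hlen := length_le_length_double hs
  unfold betaSet
  simp only [Finset.mem_image, Finset.mem_range, part_double hs]
  constructor
  · rintro ⟨i, hi, rfl⟩
    by_cases hil : i < l.length
    · left
      rw [doubleRow, if_pos hil]
      have h1 := l.part_pos_iff.mpr hil
      refine ⟨by omega, ?_⟩
      have : l.part i + 1 + i + (M - 1 - i) - M = l.part i := by omega
      rw [this]
      exact l.part_mem hil
    · right
      have h1 := doubleRow_le_length l (not_lt.mp hil)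
      refine ⟨by omega, fun hmem => ?_⟩
      obtain ⟨j, hj, hjx⟩ := l.mem_parts_iff.mp hmem
      have hd : doubleRow l i
          = ((Finset.range l.length).filter (fun j => i + 1 ≤ j + l.part j)).card := by
        rw [doubleRow, if_neg hil]
      by_cases hjc : i + 1 ≤ j + l.part j
      · have : (Finset.range (j + 1)) ⊆
            ((Finset.range l.length).filter (fun j => i + 1 ≤ j + l.part j)) := by
          intro k hk
          have hk := Finset.mem_range.mp hk
          have := hs.part_add_le (show k ≤ j by omega) hj
          simp only [Finset.mem_filter, Finset.mem_range]
          omega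
        have := Finset.card_le_card this
        rw [Finset.card_range] at this
        omega
      · have : ((Finset.range l.length).filter (fun j => i + 1 ≤ j + l.part j))
            ⊆ Finset.range j := by
          intro k hk
          simp only [Finset.mem_filter, Finset.mem_range] at hk ⊢
          by_contra hkj
          have := hs.part_add_le (show j ≤ k by omega) hk.1
          omega
        have := Finset.card_le_card this
        rw [Finset.card_range] at this
        omega
  · rintro (⟨hx, hmem⟩ | ⟨hx, hmem⟩)
    · obtain ⟨i, hi, hix⟩ := l.mem_parts_iff.mp hmem
      refine ⟨i, by omega, ?_⟩
      rw [doubleRow, if_pos hi]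
      omega
    · obtain ⟨c, hc⟩ : ∃ c, ∀ j, j < c ↔ (j < l.length ∧ M - x < l.part j) := by
        classical
        have hex : ∃ j, ¬ (j < l.length ∧ M - x < l.part j) := ⟨l.length, by simp⟩
        refine ⟨Nat.find hex, fun j => ⟨fun h => not_not.mp (Nat.find_min hex h), fun h => ?_⟩⟩
        by_contra hcon
        refine Nat.find_spec hex ⟨?_, ?_⟩
        · omega
        · exact h.2.trans_le (l.part_antitone (not_lt.mp hcon))
      have hclen : c ≤ l.length := by
        by_contra h
        have := ((hc l.length).mp (not_le.mp h)).1
        omega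
      have hlt : ∀ j, c ≤ j → j < l.length → j + l.part j < M - x + c := by
        intro j hcj hj
        have h1 := hs.part_add_le hcj hj
        have h2 : ¬ (M - x < l.part c) := fun h => by
          have := (hc c).mpr ⟨by omega, h⟩
          omega
        have h3 : l.part c ≠ M - x := fun h =>
          hmem (h ▸ l.part_mem (lt_of_le_of_lt hcj hj))
        omega
      have hge : ∀ j, j < c → M - x + c ≤ j + l.part j := by
        intro j hj
        have h1 := hs.part_add_le (show j ≤ c - 1 by omega) (by omega)
        have h2 := ((hc (c - 1)).mp (by omega)).2
        omega
      have hil : l.length ≤ M - x + c - 1 := by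
        by_contra h
        have h1 := hlt (l.length - 1) (by omega) (by omega)
        have h2 := l.part_pos_iff.mpr (show l.length - 1 < l.length by omega)
        omega
      have hd : doubleRow l (M - x + c - 1) = c := by
        rw [doubleRow, if_neg (by omega)]
        have : ((Finset.range l.length).filter
            (fun j => M - x + c - 1 + 1 ≤ j + l.part j)) = Finset.range c := by
          ext j
          simp only [Finset.mem_filter, Finset.mem_range]
          constructor
          · rintro ⟨h1, h2⟩
            by_contra h3
            have := hlt j (by omega) h1
            omega
          · intro h
            have := hge j h
            exact ⟨by omega, by omega⟩
        rw [this, Finset.card_range]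
      have hi : M - x + c - 1 < M := by
        by_cases hc0 : c = 0
        · omega
        · have : 0 < (double l).part (M - x + c - 1) := by rw [part_double hs, hd]; omega
          have := (double l).part_pos_iff.mp this
          omega
      exact ⟨M - x + c - 1, hi, by rw [hd]; omega⟩

theorem mem_runnerLevels {r : ℕ} (hr : 0 < r) {l : Ptn} {k s : ℕ} :
    s ∈ runnerLevels r l k ↔ r * s + k ∈ betaSet l (r * l.length) := by
  unfold runnerLevels
  rw [Finset.mem_filter, and_iff_right_iff_imp]
  intro h
  obtain ⟨i, hi, hx⟩ := Finset.mem_image.mp h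
  have h1 := l.part_antitone (Nat.zero_le i)
  have h2 : s ≤ r * s := Nat.le_mul_of_pos_left s hr
  rw [Finset.mem_range]
  omega

theorem mem_runnerLevels_double {l : Ptn} (hs : l.Strict) {s : ℕ} :
    s ∈ runnerLevels 3 (double l) 1 ↔
      ((double l).length ≤ s ∧ 3 * (s - (double l).length) + 1 ∈ l.parts) ∨
      (s < (double l).length ∧ 3 * ((double l).length - 1 - s) + 2 ∉ l.parts) := by
  rw [mem_runnerLevels (by norm_num), mem_betaSet_double hs (by omega)]
  refine or_congr ?_ ?_
  · constructor
    · rintro ⟨h1, h2⟩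
      refine ⟨by omega, ?_⟩
      convert h2 using 1
      omega
    · rintro ⟨h1, h2⟩
      refine ⟨by omega, ?_⟩
      convert h2 using 1
      omega
  · constructor
    · rintro ⟨h1, h2⟩
      refine ⟨by omega, ?_⟩
      convert h2 using 2
      omega
    · rintro ⟨h1, h2⟩
      refine ⟨by omega, ?_⟩
      convert h2 using 2
      omega

theorem ptnOfBeads_range_union_map (a : ℕ) (B : Finset ℕ) :
    ptnOfBeads (Finset.range a ∪ B.map (addRightEmbedding a)) = ptnOfBeads B := by
  apply Ptn.ext_parts
  have hdisj : Disjoint (Finset.range a) (B.map (addRightEmbedding a)) := by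
    rw [Finset.disjoint_left]
    intro x hx hx'
    obtain ⟨y, -, rfl⟩ := Finset.mem_map.mp hx'
    simp at hx
  have hcard : ∀ p, ((Finset.range a ∪ B.map (addRightEmbedding a)).filter
      (fun q => q < p + a)).card = a + (B.filter (fun q => q < p)).card := by
    intro p
    rw [Finset.filter_union, Finset.card_union_of_disjoint
      (hdisj.mono (Finset.filter_subset _ _) (Finset.filter_subset _ _)),
      Finset.filter_true_of_mem, Finset.card_range, Finset.filter_map, Finset.card_map]
    · congr 2
      ext q
      simp
    · intro x hx
      have := Finset.mem_range.mp hx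
      omega
  have hlow : ∀ p < a, ((Finset.range a ∪ B.map (addRightEmbedding a)).filter
      (fun q => q < p)).card = p := by
    intro p hp
    have : (Finset.range a ∪ B.map (addRightEmbedding a)).filter (fun q => q < p)
        = Finset.range p := by
      ext q
      simp only [Finset.mem_filter, Finset.mem_union, Finset.mem_range, Finset.mem_map,
        addRightEmbedding_apply]
      constructor
      · exact fun h => h.2
      · intro h
        exact ⟨Or.inl (by omega), h⟩
    rw [this, Finset.card_range]
  unfold ptnOfBeads Ptn.of
  simp only
  rw [← Finset.disjUnion_eq_union _ _ hdisj] at hcard hlow ⊢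
  rw [Finset.disjUnion_val, Multiset.map_add, Multiset.filter_add, Finset.map_val,
    Multiset.map_map]
  have h0 : Multiset.filter (fun x => 0 < x) (Multiset.map (fun p => p -
      (((Finset.range a).disjUnion (B.map (addRightEmbedding a)) hdisj).filter
        (fun q => q < p)).card) (Finset.range a).val) = 0 := by
    rw [Multiset.filter_eq_nil]
    intro x hx
    obtain ⟨p, hp, rfl⟩ := Multiset.mem_map.mp hx
    rw [hlow p (by simpa using hp)]
    omega
  rw [h0, zero_add]
  congr 1
  apply Multiset.map_congr rfl
  intro p _
  simp only [Function.comp_apply, addRightEmbedding_apply]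
  rw [hcard p]
  omega

/-- The Schur function of the partition encoded by the beads `c 0 < ⋯ < c (N - 1)`. -/
theorem schur_ptnOfBeads_of_strictMonoOn {N : ℕ} {c : ℕ → ℕ}
    (hc : ∀ i j, i < j → j < N → c i < c j) :
    schur (ptnOfBeads ((Finset.range N).image c)) =
      Matrix.det (Matrix.of fun i j : Fin N => hz ((c i : ℤ) - (j : ℤ))) := by
  have hinj : ∀ i < N, ∀ j < N, c i = c j → i = j := by
    intro i hi j hj h
    rcases lt_trichotomy i j with h' | h' | h'
    · have := hc i j h' hj; omega
    · exact h'
    · have := hc j i h' hi; omega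
  have hadd : ∀ i j, i ≤ j → j < N → c i + (j - i) ≤ c j := by
    intro i j hij
    induction j, hij using Nat.le_induction with
    | base => simp
    | succ j hij ih =>
      intro hj
      have h1 := ih (by omega)
      have h2 := hc j (j + 1) (by omega) hj
      omega
  have hle : ∀ i < N, i ≤ c i := by
    intro i hi
    have := hadd 0 i (Nat.zero_le _) hi
    omega
  have hlt : ∀ i < N, ∀ j < N, (c i < c j ↔ i < j) := by
    intro i hi j hj
    refine ⟨fun h => ?_, fun h => hc i j h hj⟩
    by_contra hn
    have := hadd j i (by omega) hi
    omega
  let f : ℕ → ℕ := fun i => if i < N then c (N - 1 - i) - (N - 1 - i) else 0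
  have hf : Antitone f := by
    intro i j hij
    simp only [f]
    by_cases hj : j < N
    · rw [if_pos hj, if_pos (by omega)]
      have := hadd (N - 1 - j) (N - 1 - i) (by omega) (by omega)
      omega
    · rw [if_neg hj]
      exact Nat.zero_le _
  have hB : (Finset.range N).image c = (Finset.range N).image (fun i => c (N - 1 - i)) := by
    ext x
    simp only [Finset.mem_image, Finset.mem_range]
    constructor
    · rintro ⟨i, hi, rfl⟩
      exact ⟨N - 1 - i, by omega, by congr 1; omega⟩
    · rintro ⟨i, hi, rfl⟩
      exact ⟨N - 1 - i, by omega, rfl⟩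
  have hrank : ∀ i < N, (((Finset.range N).image c).filter (fun q => q < c i)).card = i := by
    intro i hi
    have : ((Finset.range N).image c).filter (fun q => q < c i) = (Finset.range i).image c := by
      ext x
      simp only [Finset.mem_filter, Finset.mem_image, Finset.mem_range]
      constructor
      · rintro ⟨⟨j, hj, rfl⟩, h⟩
        exact ⟨j, (hlt j hj i hi).mp h, rfl⟩
      · rintro ⟨j, hj, rfl⟩
        exact ⟨⟨j, by omega, rfl⟩, hc j i hj hi⟩
    rw [this, Finset.card_image_of_injOn, Finset.card_range]
    intro a ha b hb h
    simp only [Finset.coe_range, Set.mem_Iio] at ha hb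
    exact hinj a (by omega) b (by omega) h
  have hptn : ptnOfBeads ((Finset.range N).image c) = Ptn.of ((Multiset.range N).map f) := by
    unfold ptnOfBeads
    congr 1
    have hval : ((Finset.range N).image c).val
        = (Multiset.range N).map (fun i => c (N - 1 - i)) := by
      rw [hB, Finset.image_val_of_injOn]
      · rfl
      · intro a ha b hb h
        simp only [Finset.coe_range, Set.mem_Iio] at ha hb
        have := hinj _ (by omega) _ (by omega) h
        omega
    rw [hval, Multiset.map_map]
    apply Multiset.map_congr rfl
    intro i hi
    have hi := Multiset.mem_range.mp hi
    simp only [Function.comp_apply, f]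
    rw [hrank _ (by omega), if_pos hi]
  rw [hptn, schur_eq_det_of_length_le _ (Ptn.length_of_map_range_le f N),
    ← Matrix.det_submatrix_equiv_self Fin.revPerm]
  congr 1
  ext1 i j
  have hi := i.isLt
  have hj := j.isLt
  simp only [Matrix.submatrix_apply, Matrix.of_apply, Fin.revPerm_apply, Fin.val_rev]
  rw [Ptn.part_of_map_range hf (fun i hi => if_neg (by omega))]
  have h1 := hle i i.isLt
  have h2 : N - 1 - (N - (i.val + 1)) = i.val := by omega
  simp only [f]
  rw [if_pos (by omega), h2]
  congr 1
  omega

/-- The Schur function of the partition encoded by the beads `b i`, listed in any order. -/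
theorem schur_ptnOfBeads_image {N : ℕ} {b : Fin N → ℕ} (hb : Function.Injective b) :
    schur (ptnOfBeads (Finset.univ.image b)) =
      (∏ j, ∏ i ∈ Finset.Iio j, (if b i < b j then 1 else -1)) *
      Matrix.det (Matrix.of fun i j : Fin N => hz ((b i : ℤ) - (j : ℤ))) := by
  have hcard : (Finset.univ.image b).card = N := by
    rw [Finset.card_image_of_injective _ hb, Finset.card_univ, Fintype.card_fin]
  set e := (Finset.univ.image b).orderIsoOfFin hcard with he
  let g : Fin N → Fin N := fun i => e.symm ⟨b i, Finset.mem_image_of_mem _ (Finset.mem_univ i)⟩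
  have hg : Function.Injective g := by
    intro i j h
    have := e.symm.injective h
    exact hb (Subtype.mk.inj this)
  let σ : Equiv.Perm (Fin N) := Equiv.ofBijective g (Finite.injective_iff_bijective.mp hg)
  have hσ : ∀ i, (e (σ i) : ℕ) = b i := by
    intro i
    change ((e (e.symm _)) : ℕ) = _
    rw [OrderIso.apply_symm_apply]
  let c : ℕ → ℕ := fun k => if h : k < N then (e ⟨k, h⟩ : ℕ) else 0
  have hcfin : ∀ i : Fin N, c i = (e i : ℕ) := by
    intro i
    simp [c]
  have hc : ∀ i j, i < j → j < N → c i < c j := by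
    intro i j hij hj
    have h1 := hcfin ⟨i, hij.trans hj⟩
    have h2 := hcfin ⟨j, hj⟩
    simp only at h1 h2
    rw [h1, h2]
    exact e.strictMono (show (⟨i, hij.trans hj⟩ : Fin N) < ⟨j, hj⟩ from hij)
  have himg : Finset.univ.image b = (Finset.range N).image c := by
    ext x
    simp only [Finset.mem_image, Finset.mem_univ, true_and, Finset.mem_range]
    constructor
    · rintro ⟨i, rfl⟩
      exact ⟨σ i, (σ i).isLt, by rw [hcfin, hσ]⟩
    · rintro ⟨k, hk, rfl⟩
      refine ⟨σ.symm ⟨k, hk⟩, ?_⟩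
      rw [← hσ, Equiv.apply_symm_apply, ← hcfin]
  have hsign : (∏ j, ∏ i ∈ Finset.Iio j, (if b i < b j then (1 : SymF) else -1))
      = ((Equiv.Perm.sign σ : ℤ) : SymF) := by
    rw [Equiv.Perm.sign_eq_prod_prod_Iio]
    push_cast
    refine Finset.prod_congr rfl fun j _ => Finset.prod_congr rfl fun i _ => ?_
    have : σ i < σ j ↔ b i < b j := by
      rw [← hσ i, ← hσ j, Subtype.coe_lt_coe, e.lt_iff_lt]
    by_cases h : b i < b j
    · simp [h, this.mpr h]
    · simp [h, this.not.mpr h]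
  have hdet : Matrix.det (Matrix.of fun i j : Fin N => hz ((b i : ℤ) - (j : ℤ)))
      = ((Equiv.Perm.sign σ : ℤ) : SymF) *
        Matrix.det (Matrix.of fun i j : Fin N => hz ((c i : ℤ) - (j : ℤ))) := by
    rw [← Matrix.det_permute]
    congr 1
    ext1 i j
    simp [hcfin, hσ]
  rw [himg, schur_ptnOfBeads_of_strictMonoOn hc, hsign, hdet, ← mul_assoc, ← Int.cast_mul]
  rcases Int.units_eq_one_or (Equiv.Perm.sign σ) with h | h <;> simp [h]

section PairedRows

variable {R : Type*} [CommRing R] {n : ℕ}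

/-- The determinant whose rows come in pairs `u (s r)`, `v (s r)`. -/
def pairedDet {ι : Type*} (u v : ι → Fin n × Fin 2 → R) (s : Fin n → ι) : R :=
  Matrix.det (Matrix.of fun (p : Fin n × Fin 2) j => if p.2 = 0 then u (s p.1) j else v (s p.1) j)

/-- The alternating sum over permutations of products of entries of `B`, which is the `n`-th
power of the 2-form with coefficients `B`. -/
def altPairSum (B : Fin n × Fin 2 → Fin n × Fin 2 → R) : R :=
  ∑ σ : Equiv.Perm (Fin n × Fin 2),
    ((Equiv.Perm.sign σ : ℤ) : R) * ∏ r : Fin n, B (σ (r, 0)) (σ (r, 1))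

theorem sum_pairedDet {ι : Type*} [DecidableEq ι] (T : Finset ι)
    (u v : ι → Fin n × Fin 2 → R) :
    ∑ s ∈ Fintype.piFinset (fun _ : Fin n => T), pairedDet u v s
      = altPairSum fun j k => ∑ a ∈ T, u a j * v a k := by
  unfold pairedDet altPairSum
  simp_rw [← Matrix.det_transpose (Matrix.of _), Matrix.det_apply', Finset.prod_univ_sum,
    Finset.mul_sum]
  rw [Finset.sum_comm]
  refine Finset.sum_congr rfl fun σ _ => Finset.sum_congr rfl fun s _ => ?_
  congr 1
  rw [Fintype.prod_prod_type]
  refine Finset.prod_congr rfl fun r _ => ?_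
  simp [Fin.prod_univ_two]

theorem two_pow_mul_altPairSum (B : Fin n × Fin 2 → Fin n × Fin 2 → R) :
    2 ^ n * altPairSum B = altPairSum fun j k => B j k - B k j := by
  unfold altPairSum
  have hperm : ∀ σ : Equiv.Perm (Fin n × Fin 2), ∀ r : Fin n,
      B (σ (r, 0)) (σ (r, 1)) - B (σ (r, 1)) (σ (r, 0))
        = ∑ τ : Equiv.Perm (Fin 2),
          ((Equiv.Perm.sign τ : ℤ) : R) * B (σ (r, τ 0)) (σ (r, τ 1)) := by
    intro σ r
    have huniv : (Finset.univ : Finset (Equiv.Perm (Fin 2))) = {1, Equiv.swap 0 1} := by decide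
    rw [huniv, Finset.sum_pair (by decide)]
    simp [sub_eq_add_neg]
  simp_rw [hperm, Finset.prod_univ_sum, Finset.mul_sum]
  rw [Finset.sum_comm]
  have hterm : ∀ τ : Fin n → Equiv.Perm (Fin 2),
      ∑ σ : Equiv.Perm (Fin n × Fin 2), ((Equiv.Perm.sign σ : ℤ) : R) *
        ∏ r : Fin n, (((Equiv.Perm.sign (τ r) : ℤ) : R) *
          B (σ (r, τ r 0)) (σ (r, τ r 1)))
      = ∑ σ : Equiv.Perm (Fin n × Fin 2),
        ((Equiv.Perm.sign σ : ℤ) : R) * ∏ r : Fin n, B (σ (r, 0)) (σ (r, 1)) := by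
    intro τ
    refine Fintype.sum_equiv (Equiv.mulRight (Equiv.prodCongrRight τ)) _ _ fun σ => ?_
    rw [Finset.prod_mul_distrib, ← mul_assoc]
    simp [Equiv.Perm.sign_prodCongrRight]
  rw [Fintype.piFinset_univ, Finset.sum_congr rfl fun τ _ => hterm τ, Finset.sum_const,
    Finset.card_univ, Fintype.card_fun, Fintype.card_perm, Fintype.card_fin, Fintype.card_fin]
  simp [Finset.mul_sum]

theorem pairedDet_comp_perm {ι : Type*} (u v : ι → Fin n × Fin 2 → R) (s : Fin n → ι)
    (π : Equiv.Perm (Fin n)) : pairedDet u v (s ∘ π) = pairedDet u v s := by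
  unfold pairedDet
  have hsign : Equiv.Perm.sign (Equiv.prodCongrLeft (fun _ : Fin 2 => π)) = 1 := by
    rw [Equiv.Perm.sign_prodCongrLeft]
    simp
  have := Matrix.det_permute (Equiv.prodCongrLeft (fun _ : Fin 2 => π))
    (Matrix.of fun (p : Fin n × Fin 2) j => if p.2 = 0 then u (s p.1) j else v (s p.1) j)
  rw [hsign] at this
  simp only [Units.val_one, Int.cast_one, one_mul] at this
  rw [← this]
  rfl

theorem pairedDet_of_not_injective {ι : Type*} (u v : ι → Fin n × Fin 2 → R) {s : Fin n → ι}
    (hs : ¬ Function.Injective s) : pairedDet u v s = 0 := by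
  unfold Function.Injective at hs
  push Not at hs
  obtain ⟨a, b, hab, hne⟩ := hs
  refine Matrix.det_zero_of_row_eq (i := (a, 0)) (j := (b, 0)) (by simpa using hne) ?_
  ext j
  simp [hab]

/-- A symmetric function on `n`-tuples that vanishes on tuples with repetitions, summed over all
tuples. -/
theorem sum_piFinset_eq_factorial_mul {ι : Type*} [LinearOrder ι] (T : Finset ι)
    {f : (Fin n → ι) → R} (hperm : ∀ s (π : Equiv.Perm (Fin n)), f (s ∘ π) = f s)
    (hinj : ∀ s, ¬ Function.Injective s → f s = 0) {g : Finset ι → R}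
    (hg : ∀ s : Fin n → ι, StrictMono s → (∀ r, s r ∈ T) → f s = g (Finset.univ.image s)) :
    ∑ s ∈ Fintype.piFinset (fun _ : Fin n => T), f s
      = (n.factorial : R) * ∑ S ∈ T.powersetCard n, g S := by
  classical
  rw [← Finset.sum_filter_of_ne (p := Function.Injective)
    (fun s _ h => by_contra fun hc => h (hinj s hc))]
  have hmaps : ∀ s ∈ (Fintype.piFinset (fun _ : Fin n => T)).filter Function.Injective,
      Finset.univ.image s ∈ T.powersetCard n := by
    intro s hs
    rw [Finset.mem_filter, Fintype.mem_piFinset] at hs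
    rw [Finset.mem_powersetCard, Finset.card_image_of_injective _ hs.2, Finset.card_univ,
      Fintype.card_fin]
    refine ⟨fun x hx => ?_, rfl⟩
    obtain ⟨r, -, rfl⟩ := Finset.mem_image.mp hx
    exact hs.1 r
  rw [← Finset.sum_fiberwise_of_maps_to hmaps, Finset.mul_sum]
  refine Finset.sum_congr rfl fun S hS => ?_
  obtain ⟨hST, hcard⟩ := Finset.mem_powersetCard.mp hS
  let e := S.orderEmbOfFin hcard
  have heimg : Finset.univ.image e = S := Finset.image_orderEmbOfFin_univ S hcard
  have hge : f e = g S := by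
    rw [hg e e.strictMono (fun r => hST (Finset.orderEmbOfFin_mem S hcard r)), heimg]
  have hbij : ∑ π : Equiv.Perm (Fin n), f (e ∘ π) = ∑ s ∈ ((Fintype.piFinset
      (fun _ : Fin n => T)).filter Function.Injective).filter
        (fun s => Finset.univ.image s = S), f s := by
    refine Finset.sum_bij (fun π _ => e ∘ π) ?_ ?_ ?_ (fun _ _ => rfl)
    · intro π _
      rw [Finset.mem_filter, Finset.mem_filter, Fintype.mem_piFinset]
      refine ⟨⟨fun r => hST (Finset.orderEmbOfFin_mem S hcard _),
        e.injective.comp π.injective⟩, ?_⟩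
      rw [← heimg, ← Finset.image_image, Finset.image_univ_equiv]
    · intro π _ ρ _ h
      ext r
      have := e.injective (congrFun h r)
      rw [this]
    · intro s hs
      rw [Finset.mem_filter, Finset.mem_filter] at hs
      have hmem : ∀ r, ∃ k, e k = s r := by
        intro r
        have : s r ∈ Finset.univ.image e := by
          rw [heimg, ← hs.2]
          exact Finset.mem_image_of_mem _ (Finset.mem_univ r)
        obtain ⟨k, -, hk⟩ := Finset.mem_image.mp this
        exact ⟨k, hk⟩
      choose p hp using hmem
      have hpinj : Function.Injective p := by
        intro a b hab
        apply hs.1.2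
        rw [← hp a, ← hp b, hab]
      refine ⟨Equiv.ofBijective p (Finite.injective_iff_bijective.mp hpinj),
        Finset.mem_univ _, ?_⟩
      ext r
      exact hp r
  rw [← hbij, Finset.sum_congr rfl fun π _ => hperm e π, Finset.sum_const, Finset.card_univ,
    Fintype.card_perm, Fintype.card_fin, nsmul_eq_mul, hge]

/-- The sum of the minors of paired rows only depends on the 2-form `∑ u_a ∧ v_a`.  If this
form is `∑ C i k • e_(i,0) ∧ e_(k,1)`, then the sum is the determinant of `C`. -/
theorem sum_powersetCard_pairedDet [IsDomain R] [CharZero R] {ι : Type*} [LinearOrder ι]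
    (T : Finset ι) (u v : ι → Fin n × Fin 2 → R) (C : Matrix (Fin n) (Fin n) R)
    (h00 : ∀ i k, ∑ a ∈ T, u a (i, 0) * v a (k, 0) = ∑ a ∈ T, u a (k, 0) * v a (i, 0))
    (h11 : ∀ i k, ∑ a ∈ T, u a (i, 1) * v a (k, 1) = ∑ a ∈ T, u a (k, 1) * v a (i, 1))
    (h01 : ∀ i k, ∑ a ∈ T, u a (i, 0) * v a (k, 1) - ∑ a ∈ T, u a (k, 1) * v a (i, 0) = C i k)
    {g : Finset ι → R} (hg : ∀ s : Fin n → ι, StrictMono s → (∀ r, s r ∈ T) →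
      pairedDet u v s = g (Finset.univ.image s)) :
    ∑ S ∈ T.powersetCard n, g S = C.det := by
  classical
  let x : Fin n → Fin n × Fin 2 → R := fun i j => if j = (i, 0) then 1 else 0
  let y : Fin n → Fin n × Fin 2 → R := fun i j => if j.2 = 1 then C i j.1 else 0
  have hxy : ∑ s ∈ Fintype.piFinset (fun _ : Fin n => (Finset.univ : Finset (Fin n))),
      pairedDet x y s = (n.factorial : R) * C.det := by
    rw [sum_piFinset_eq_factorial_mul (g := fun _ => C.det) _ (pairedDet_comp_perm x y)
      (fun s => pairedDet_of_not_injective x y)]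
    · have : (Finset.univ : Finset (Fin n)).powersetCard n = {Finset.univ} := by
        simpa using Finset.powersetCard_self (Finset.univ : Finset (Fin n))
      rw [this, Finset.sum_singleton]
    · intro s hs _
      have hid : s = id := by
        have := Finset.orderEmbOfFin_unique (s := (Finset.univ : Finset (Fin n))) (by simp)
          (fun r => Finset.mem_univ (s r)) hs
        have h' := Finset.orderEmbOfFin_unique (s := (Finset.univ : Finset (Fin n))) (by simp)
          (fun r => Finset.mem_univ (id r)) strictMono_id
        rw [this, h']
      subst hid
      let e : Fin n ⊕ Fin n ≃ Fin n × Fin 2 :=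
        { toFun := Sum.elim (fun i => (i, 0)) (fun i => (i, 1))
          invFun := fun p => if p.2 = 0 then Sum.inl p.1 else Sum.inr p.1
          left_inv := by rintro (i | i) <;> simp
          right_inv := by
            rintro ⟨i, b⟩
            fin_cases b <;> simp }
      unfold pairedDet
      rw [← Matrix.det_submatrix_equiv_self e]
      have : (Matrix.of fun (p : Fin n × Fin 2) j =>
          if p.2 = 0 then x (id p.1) j else y (id p.1) j).submatrix e e
          = Matrix.fromBlocks 1 0 0 C := by
        ext a b
        rcases a with i | i <;> rcases b with k | k <;>
          simp [e, x, y, Matrix.one_apply, eq_comm]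
      rw [this, Matrix.det_fromBlocks_zero₂₁]
      simp
  have huv := sum_piFinset_eq_factorial_mul T (pairedDet_comp_perm u v)
    (fun s => pairedDet_of_not_injective u v) hg
  rw [sum_pairedDet] at hxy huv
  have hform : ∀ j k : Fin n × Fin 2,
      (∑ a ∈ T, u a j * v a k) - (∑ a ∈ T, u a k * v a j)
        = (∑ a, x a j * y a k) - (∑ a, x a k * y a j) := by
    rintro ⟨i, b⟩ ⟨k, c⟩
    fin_cases b <;> fin_cases c
    · simp [x, y, h00 i k]
    · simp [x, y, h01 i k]
    · simp [x, y, ← h01 k i]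
    · simp [x, y, h11 i k]
  have h2 : (2 : R) ^ n * altPairSum (fun j k => ∑ a ∈ T, u a j * v a k)
      = 2 ^ n * altPairSum (fun j k => ∑ a, x a j * y a k) := by
    rw [two_pow_mul_altPairSum, two_pow_mul_altPairSum]
    simp_rw [hform]
  have h3 := mul_left_cancel₀ (pow_ne_zero n two_ne_zero) h2
  rw [hxy, huv] at h3
  exact mul_left_cancel₀ (Nat.cast_ne_zero.mpr n.factorial_ne_zero) h3

end PairedRows

theorem zval_cons {a : ℕ} (s : Multiset ℕ) :
    zval (a ::ₘ s) = (a : ℚ) * ((a ::ₘ s).count a : ℚ) * zval s := by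
  unfold zval
  have hsub : s.toFinset ⊆ insert a s.toFinset := Finset.subset_insert _ _
  have h1 : s.toFinset.prod (fun b => (b : ℚ) ^ s.count b * ((s.count b).factorial : ℚ))
      = (insert a s.toFinset).prod
        (fun b => (b : ℚ) ^ s.count b * ((s.count b).factorial : ℚ)) := by
    apply Finset.prod_subset hsub
    intro b _ hb
    have : s.count b = 0 := Multiset.count_eq_zero.mpr (by simpa using hb)
    simp [this]
  rw [h1, Multiset.toFinset_cons, ← Finset.mul_prod_erase _ _ (Finset.mem_insert_self a _),
    ← Finset.mul_prod_erase (insert a s.toFinset) _ (Finset.mem_insert_self a _), ← mul_assoc]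
  congr 1
  · rw [Multiset.count_cons_self, Nat.factorial_succ]
    push_cast
    ring
  · refine Finset.prod_congr rfl fun b hb => ?_
    rw [Multiset.count_cons_of_ne (Finset.ne_of_mem_erase hb)]

theorem zval_ne_zero {s : Multiset ℕ} (hs : ∀ x ∈ s, 0 < x) : zval s ≠ 0 := by
  unfold zval
  refine Finset.prod_ne_zero_iff.mpr fun a ha => ?_
  have : 0 < a := hs a (Multiset.mem_toFinset.mp ha)
  positivity

/-- Newton's identity `n h_n = p_1 h_{n-1} + ⋯ + p_n h_0`. -/
theorem nsmul_hSym (n : ℕ) :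
    (n : SymF) * hSym n = ∑ k ∈ Finset.range n, X k * hSym (n - 1 - k) := by
  have hR : ∀ k ∈ Finset.range n, (X k : SymF) * hSym (n - 1 - k)
      = ∑ ρ : Nat.Partition n, if k + 1 ∈ ρ.parts then
          (((k + 1 : ℕ) : ℚ) * (ρ.parts.count (k + 1) : ℚ) * (zval ρ.parts)⁻¹) • pMult ρ.parts
        else 0 := by
    intro k hk
    have hk := Finset.mem_range.mp hk
    rw [← Finset.sum_filter, hSym, Finset.mul_sum]
    refine Finset.sum_bij (fun σ _ => (⟨(k + 1) ::ₘ σ.parts, ?_, ?_⟩ : Nat.Partition n))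
      ?_ ?_ ?_ ?_
    · intro i hi
      rcases Multiset.mem_cons.mp hi with rfl | h
      · omega
      · exact σ.parts_pos h
    · rw [Multiset.sum_cons, σ.parts_sum]
      omega
    · intro σ _
      simp
    · intro σ _ σ' _ h
      have := congrArg Nat.Partition.parts h
      exact Nat.Partition.ext ((Multiset.cons_inj_right _).mp this)
    · intro ρ hρ
      have hmem := (Finset.mem_filter.mp hρ).2
      have hcons := Multiset.cons_erase hmem
      refine ⟨⟨ρ.parts.erase (k + 1), ?_, ?_⟩, Finset.mem_univ _, ?_⟩
      · intro i hi
        exact ρ.parts_pos (Multiset.mem_of_mem_erase hi)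
      · have := ρ.parts_sum
        rw [← hcons, Multiset.sum_cons] at this
        omega
      · exact Nat.Partition.ext hcons
    · intro σ _
      simp only
      have hz := zval_ne_zero (s := σ.parts) (fun x hx => σ.parts_pos hx)
      have hp : pMult ((k + 1) ::ₘ σ.parts) = X k * pMult σ.parts := by
        simp [pMult]
      rw [zval_cons, hp, mul_smul_comm]
      congr 1
      have h1 : ((k + 1 : ℕ) : ℚ) ≠ 0 := by positivity
      have h2 : (((k + 1) ::ₘ σ.parts).count (k + 1) : ℚ) ≠ 0 := by
        rw [Multiset.count_cons_self]
        positivity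
      field_simp
  rw [Finset.sum_congr rfl hR, Finset.sum_comm, hSym, Finset.mul_sum]
  refine Finset.sum_congr rfl fun ρ _ => ?_
  have hn : (n : ℚ) = ∑ k ∈ Finset.range n,
      if k + 1 ∈ ρ.parts then ((k + 1 : ℕ) : ℚ) * (ρ.parts.count (k + 1) : ℚ) else 0 := by
    have h1 : n = ∑ k ∈ Finset.range n, ρ.parts.count (k + 1) * (k + 1) := by
      conv_lhs => rw [← ρ.parts_sum, Finset.sum_multiset_count_of_subset ρ.parts
        ((Finset.range n).image (· + 1)) (by
          intro x hx
          have hx := Multiset.mem_toFinset.mp hx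
          have h1 := ρ.parts_pos hx
          have h2 := Multiset.le_sum_of_mem hx
          rw [ρ.parts_sum] at h2
          exact Finset.mem_image.mpr ⟨x - 1, Finset.mem_range.mpr (by omega), by omega⟩)]
      rw [Finset.sum_image (by intro a _ b _ h; exact Nat.succ_injective h)]
      simp
    conv_lhs => rw [h1]
    push_cast
    refine Finset.sum_congr rfl fun k _ => ?_
    split_ifs with h
    · ring
    · rw [Multiset.count_eq_zero.mpr h]
      simp
  have hcast : (n : SymF) = C (n : ℚ) := by simp
  rw [hcast, C_mul', smul_smul]
  conv_lhs => rw [hn, Finset.sum_mul, Finset.sum_smul]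
  refine Finset.sum_congr rfl fun k _ => ?_
  split_ifs
  · rfl
  · simp

theorem pleth_hSym_nsmul (n : ℕ) :
    (n : SymF) * pleth 2 (hSym n)
      = ∑ k ∈ Finset.range n, X (2 * k + 1) * pleth 2 (hSym (n - 1 - k)) := by
  have h := congrArg (aeval (R := ℚ) (fun n => (X (2 * (n + 1) - 1) : SymF))) (nsmul_hSym n)
  rw [map_mul, map_natCast, map_sum] at h
  unfold pleth
  rw [h]
  refine Finset.sum_congr rfl fun k _ => ?_
  rw [map_mul, aeval_X]
  rfl

theorem PowerSeries.eq_of_derivative_eq_mul {R : Type*} [CommRing R] [IsDomain R] [CharZero R]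
    {F K W : PowerSeries R} (hF : PowerSeries.derivative R F = W * F)
    (hK : PowerSeries.derivative R K = W * K)
    (h0 : PowerSeries.coeff 0 F = PowerSeries.coeff 0 K) : F = K := by
  ext n
  induction n using Nat.strong_induction_on with
  | _ n ih =>
    cases n with
    | zero => exact h0
    | succ n =>
      have h1 := congrArg (PowerSeries.coeff n) hF
      have h2 := congrArg (PowerSeries.coeff n) hK
      rw [PowerSeries.coeff_derivative, PowerSeries.coeff_mul] at h1 h2
      have h3 : ∑ p ∈ Finset.HasAntidiagonal.antidiagonal n, PowerSeries.coeff p.1 W * PowerSeries.coeff p.2 F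
          = ∑ p ∈ Finset.HasAntidiagonal.antidiagonal n, PowerSeries.coeff p.1 W * PowerSeries.coeff p.2 K := by
        refine Finset.sum_congr rfl fun p hp => ?_
        rw [ih p.2 (by have := Finset.HasAntidiagonal.mem_antidiagonal.mp hp; omega)]
      have h4 : PowerSeries.coeff (n + 1) F * ((n : R) + 1)
          = PowerSeries.coeff (n + 1) K * ((n : R) + 1) := by
        rw [h1, h2, h3]
      exact mul_right_cancel₀ (Nat.cast_add_one_ne_zero n) h4

theorem pleth_one (r : ℕ) : pleth r 1 = 1 := map_one _

/-- `H(-t) H(t)` is the generating function of the `p_2 ∘ h_k` in `t ^ 2`. -/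
theorem sum_antidiagonal_neg_one_pow_hSym (N : ℕ) :
    ∑ p ∈ Finset.HasAntidiagonal.antidiagonal N, ((-1 : SymF) ^ p.1 * hSym p.1) * hSym p.2
      = if N % 2 = 0 then pleth 2 (hSym (N / 2)) else 0 := by
  let H : PowerSeries SymF := PowerSeries.mk hSym
  let H' : PowerSeries SymF := PowerSeries.mk fun n => (-1) ^ n * hSym n
  let K : PowerSeries SymF := PowerSeries.mk fun n =>
    if n % 2 = 0 then pleth 2 (hSym (n / 2)) else 0
  let P : PowerSeries SymF := PowerSeries.mk fun n => (X n : SymF)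
  let P' : PowerSeries SymF := PowerSeries.mk fun n => -((-1) ^ n * (X n : SymF))
  have hnewton : ∀ n, hSym (n + 1) * ((n : SymF) + 1)
      = ∑ p ∈ Finset.HasAntidiagonal.antidiagonal n, (X p.1 : SymF) * hSym p.2 := by
    intro n
    rw [Finset.Nat.sum_antidiagonal_eq_sum_range_succ (fun i j => (X i : SymF) * hSym j),
      mul_comm]
    have := nsmul_hSym (n + 1)
    push_cast at this
    rw [this]
  have hH : PowerSeries.derivative SymF H = P * H := by
    ext1 n
    rw [PowerSeries.coeff_derivative, PowerSeries.coeff_mul]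
    simp only [H, P, PowerSeries.coeff_mk]
    exact hnewton n
  have hH' : PowerSeries.derivative SymF H' = P' * H' := by
    ext1 n
    rw [PowerSeries.coeff_derivative, PowerSeries.coeff_mul]
    simp only [H', P', PowerSeries.coeff_mk]
    rw [mul_assoc, hnewton n, Finset.mul_sum]
    refine Finset.sum_congr rfl fun p hp => ?_
    rw [← Finset.HasAntidiagonal.mem_antidiagonal.mp hp, pow_succ, pow_add]
    ring
  have hG : PowerSeries.derivative SymF (H' * H) = (P + P') * (H' * H) := by
    rw [Derivation.leibniz, hH, hH', smul_eq_mul, smul_eq_mul]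
    ring
  have hK : PowerSeries.derivative SymF K = (P + P') * K := by
    ext1 n
    rw [PowerSeries.coeff_derivative, PowerSeries.coeff_mul]
    simp only [K, P, P', PowerSeries.coeff_mk, map_add]
    rw [Finset.Nat.sum_antidiagonal_eq_sum_range_succ (fun i j => ((X i : SymF) +
      -((-1) ^ i * (X i : SymF))) * (if j % 2 = 0 then pleth 2 (hSym (j / 2)) else 0))]
    rcases Nat.even_or_odd' n with ⟨q, rfl | rfl⟩
    · rw [if_neg (by omega), zero_mul, Finset.sum_eq_zero]
      intro k hk
      have hk := Finset.mem_range.mp hk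
      rcases Nat.even_or_odd' k with ⟨r, rfl | rfl⟩
      · simp [pow_mul]
      · rw [if_neg (by omega), mul_zero]
    · rw [if_pos (by omega)]
      have hq : (2 * q + 1 + 1) / 2 = q + 1 := by omega
      have h1 := pleth_hSym_nsmul (q + 1)
      rw [hq]
      have h2 : ∑ k ∈ Finset.range (2 * q + 1).succ, ((X k : SymF) + -((-1) ^ k * (X k : SymF))) *
          (if (2 * q + 1 - k) % 2 = 0 then pleth 2 (hSym ((2 * q + 1 - k) / 2)) else 0)
          = ∑ k ∈ (Finset.range (q + 1)).image (fun k => 2 * k + 1),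
            ((X k : SymF) + -((-1) ^ k * (X k : SymF))) *
          (if (2 * q + 1 - k) % 2 = 0 then pleth 2 (hSym ((2 * q + 1 - k) / 2)) else 0) := by
        symm
        apply Finset.sum_subset
        · intro x hx
          obtain ⟨k, hk, rfl⟩ := Finset.mem_image.mp hx
          have := Finset.mem_range.mp hk
          exact Finset.mem_range.mpr (by omega)
        · intro k hk hk'
          have hk := Finset.mem_range.mp hk
          rcases Nat.even_or_odd' k with ⟨r, rfl | rfl⟩
          · simp [pow_mul]
          · exact absurd (Finset.mem_image.mpr ⟨r, Finset.mem_range.mpr (by omega), rfl⟩) hk'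
      rw [h2, Finset.sum_image (by intro a _ b _ h; simpa using h)]
      have h3 : pleth 2 (hSym (q + 1)) * (((2 * q + 1 : ℕ) : SymF) + 1)
          = 2 * (((q + 1 : ℕ) : SymF) * pleth 2 (hSym (q + 1))) := by
        push_cast
        ring
      rw [h3, h1, Finset.mul_sum]
      refine Finset.sum_congr rfl fun k hk => ?_
      have hk := Finset.mem_range.mp hk
      have e1 : (2 * q + 1 - (2 * k + 1)) % 2 = 0 := by omega
      have e2 : (2 * q + 1 - (2 * k + 1)) / 2 = q + 1 - 1 - k := by omega
      rw [if_pos e1, e2, pow_succ, pow_mul]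
      norm_num
      ring
  have h0 : PowerSeries.coeff 0 (H' * H) = PowerSeries.coeff 0 K := by
    rw [PowerSeries.coeff_mul]
    simp [H, H', K, hSym_zero, pleth_one]
  have := congrArg (PowerSeries.coeff N) (PowerSeries.eq_of_derivative_eq_mul hG hK h0)
  rw [PowerSeries.coeff_mul] at this
  simpa only [H, H', K, PowerSeries.coeff_mk] using this

theorem sum_range_hz_mul_hz (N j k : ℕ) :
    ∑ a ∈ Finset.range (N + j + k + 1),
        (-1 : SymF) ^ a * hz ((a : ℤ) - j) * hz (((N + j + k : ℕ) : ℤ) - a - k)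
      = (-1) ^ j * if N % 2 = 0 then pleth 2 (hSym (N / 2)) else 0 := by
  rw [← sum_antidiagonal_neg_one_pow_hSym,
    Finset.Nat.sum_antidiagonal_eq_sum_range_succ (fun a b => ((-1 : SymF) ^ a * hSym a) * hSym b),
    Finset.mul_sum]
  have hsub : (Finset.range N.succ).map (addRightEmbedding j) ⊆ Finset.range (N + j + k + 1) := by
    intro x hx
    obtain ⟨a, ha, rfl⟩ := Finset.mem_map.mp hx
    have := Finset.mem_range.mp ha
    simp only [addRightEmbedding_apply, Finset.mem_range]
    omega
  rw [← Finset.sum_subset hsub, Finset.sum_map]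
  · refine Finset.sum_congr rfl fun a ha => ?_
    have ha := Finset.mem_range.mp ha
    have e1 : ((a + j : ℕ) : ℤ) - j = (a : ℕ) := by push_cast; ring
    have e2 : ((N + j + k : ℕ) : ℤ) - ((a + j : ℕ) : ℤ) - k = ((N - a : ℕ) : ℤ) := by
      omega
    rw [addRightEmbedding_apply, e1, e2, hz_natCast, hz_natCast, pow_add]
    ring
  · intro a _ ha
    by_cases h : a < j
    · rw [hz_of_neg (by omega)]
      ring
    · rw [hz_of_neg (k := ((N + j + k : ℕ) : ℤ) - a - k), mul_zero]
      by_contra h'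
      exact ha (Finset.mem_map.mpr ⟨a - j, Finset.mem_range.mpr (by omega), by
        simp only [addRightEmbedding_apply]; omega⟩)

theorem sum_range_hz_mul_hz_of_lt {M j k : ℕ} (h : M < j + k) :
    ∑ a ∈ Finset.range (M + 1),
        (-1 : SymF) ^ a * hz ((a : ℤ) - j) * hz ((M : ℤ) - a - k) = 0 := by
  refine Finset.sum_eq_zero fun a _ => ?_
  by_cases h' : a < j
  · rw [hz_of_neg (by omega)]
    ring
  · rw [hz_of_neg (k := (M : ℤ) - a - k) (by omega), mul_zero]

/-- The antisymmetrised product sum over a symmetric window of bead positions. -/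
theorem sum_range_hz_antisymm (L j k : ℕ) :
    ∑ s ∈ Finset.range (L + 1),
        ((-1 : SymF) ^ s * hz ((L : ℤ) - s - j)) * hz (((L + 1 : ℕ) : ℤ) + s - k)
      - ∑ s ∈ Finset.range (L + 1),
        ((-1 : SymF) ^ s * hz ((L : ℤ) - s - k)) * hz (((L + 1 : ℕ) : ℤ) + s - j)
      = (-1) ^ L * ∑ a ∈ Finset.range (2 * L + 1 + 1),
        (-1 : SymF) ^ a * hz ((a : ℤ) - j) * hz (((2 * L + 1 : ℕ) : ℤ) - a - k) := by
  have e : 2 * L + 1 + 1 = (L + 1) + (L + 1) := by ring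
  rw [e, Finset.sum_range_add _ (L + 1) (L + 1), mul_add, sub_eq_add_neg]
  congr 1
  · rw [← Finset.sum_range_reflect, Finset.mul_sum]
    refine Finset.sum_congr rfl fun a ha => ?_
    have ha := Finset.mem_range.mp ha
    have e1 : L + 1 - 1 - a = L - a := by omega
    have e2 : (-1 : SymF) ^ L = (-1) ^ (L - a) * (-1) ^ a := by
      rw [← pow_add]; congr 1; omega
    have e3 : (-1 : SymF) ^ a * (-1) ^ a = 1 := by rw [← mul_pow]; simp
    have e4 : (L : ℤ) - ((L - a : ℕ) : ℤ) - j = a - j := by omega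
    have e5 : ((L + 1 : ℕ) : ℤ) + ((L - a : ℕ) : ℤ) - k = ((2 * L + 1 : ℕ) : ℤ) - a - k := by
      omega
    rw [e1, e2, e4, e5]
    linear_combination (-(-1) ^ (L - a) * hz (a - j) * hz (((2 * L + 1 : ℕ) : ℤ) - a - k)) * e3
  · rw [← Finset.sum_neg_distrib, Finset.mul_sum]
    refine Finset.sum_congr rfl fun s _ => ?_
    have e3 : (-1 : SymF) ^ L * (-1) ^ L = 1 := by rw [← mul_pow]; simp
    have e4 : ((L + 1 + s : ℕ) : ℤ) - j = ((L + 1 : ℕ) : ℤ) + s - j := by push_cast; ring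
    have e5 : ((2 * L + 1 : ℕ) : ℤ) - ((L + 1 + s : ℕ) : ℤ) - k = L - s - k := by
      push_cast; ring
    rw [e4, e5, pow_add, pow_succ]
    linear_combination ((-1) ^ s * hz (((L + 1 : ℕ) : ℤ) + s - j) * hz ((L : ℤ) - s - k)) * e3

theorem sum_range_hz_of_even {L j k : ℕ} (h : Even (j + k)) :
    ∑ a ∈ Finset.range (2 * L + 1 + 1),
        (-1 : SymF) ^ a * hz ((a : ℤ) - j) * hz (((2 * L + 1 : ℕ) : ℤ) - a - k) = 0 := by
  by_cases hlt : 2 * L + 1 < j + k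
  · exact sum_range_hz_mul_hz_of_lt hlt
  · obtain ⟨N, hN⟩ := Nat.exists_eq_add_of_le (not_lt.mp hlt)
    have e : 2 * L + 1 = N + j + k := by omega
    rw [e, sum_range_hz_mul_hz, if_neg, mul_zero]
    obtain ⟨r, hr⟩ := h
    omega

theorem sum_range_hz_of_odd (L i k : ℕ) :
    ∑ a ∈ Finset.range (2 * L + 1 + 1),
        (-1 : SymF) ^ a * hz ((a : ℤ) - (2 * i : ℕ)) *
          hz (((2 * L + 1 : ℕ) : ℤ) - a - (2 * k + 1 : ℕ))
      = pleth 2 (hz ((L : ℤ) - i - k)) := by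
  by_cases hlt : L < i + k
  · rw [sum_range_hz_mul_hz_of_lt (by omega), hz_of_neg (by omega)]
    simp [pleth]
  · have e : 2 * L + 1 = 2 * (L - i - k) + 2 * i + (2 * k + 1) := by omega
    have e2 : (L : ℤ) - i - k = ((L - i - k : ℕ) : ℤ) := by omega
    rw [e2, hz_natCast]
    conv_lhs => rw [e]
    rw [sum_range_hz_mul_hz, if_pos (by omega), pow_mul]
    simp

/-- The bead positions `L - s` and `L + 1 + s`, `s ∈ S`, symmetric about `L + 1 / 2`. -/
def symmBeads (L : ℕ) (S : Finset ℕ) : Finset ℕ :=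
  S.image (fun s => L - s) ∪ S.image (fun s => L + 1 + s)

theorem pairedDet_symm_eq {n : ℕ} (L : ℕ) (s : Fin n → ℕ) (hs : StrictMono s)
    (hL : ∀ r, s r ≤ L) :
    pairedDet
        (fun (s : ℕ) p => (-1 : SymF) ^ s * hz ((L : ℤ) - s - (2 * p.1 + p.2 : ℕ)))
        (fun (s : ℕ) p => hz (((L + 1 : ℕ) : ℤ) + s - (2 * p.1 + p.2 : ℕ))) s
      = (-1) ^ (∑ x ∈ Finset.univ.image s, x) *
        schur (ptnOfBeads (symmBeads L (Finset.univ.image s))) := by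
  let c : Fin n × Fin 2 → ℕ := fun p => if p.2 = 0 then L - s p.1 else L + 1 + s p.1
  let b : Fin (n * 2) → ℕ := fun i => c (finProdFinEquiv.symm i)
  have hc : Function.Injective c := by
    rintro ⟨p, x⟩ ⟨q, y⟩ h
    have h1 := hL p
    have h2 := hL q
    have : p = q ∧ x = y := by
      fin_cases x <;> fin_cases y <;> simp [c] at h ⊢
      · exact hs.injective (by omega)
      · omega
      · omega
      · exact hs.injective h
    rw [this.1, this.2]
  have hb : Function.Injective b := hc.comp finProdFinEquiv.symm.injective
  have himg : Finset.univ.image b = symmBeads L (Finset.univ.image s) := by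
    ext x
    simp only [b, symmBeads, Finset.mem_image, Finset.mem_univ, true_and, Finset.mem_union,
      exists_exists_eq_and]
    constructor
    · rintro ⟨i, rfl⟩
      by_cases h : (finProdFinEquiv.symm i).2 = 0
      · exact Or.inl ⟨(finProdFinEquiv.symm i).1, by simp only [c, if_pos h]⟩
      · exact Or.inr ⟨(finProdFinEquiv.symm i).1, by simp only [c, if_neg h]⟩
    · rintro (⟨r, rfl⟩ | ⟨r, rfl⟩)
      · exact ⟨finProdFinEquiv (r, 0), by simp [c]⟩
      · exact ⟨finProdFinEquiv (r, 1), by simp [c]⟩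
  have hlt : ∀ i j : Fin (n * 2), i < j → (b i < b j ↔ (j : ℕ) % 2 = 1) := by
    intro i j hij
    obtain ⟨⟨p, x⟩, rfl⟩ := finProdFinEquiv.surjective i
    obtain ⟨⟨q, y⟩, rfl⟩ := finProdFinEquiv.surjective j
    have hij' : (x : ℕ) + 2 * p < y + 2 * q := hij
    have h1 := hL p
    have h2 := hL q
    have hpq : p ≤ q := by
      rw [Fin.le_def]
      omega
    have hspq := hs.monotone hpq
    have hspq' : (p : ℕ) < q → s p < s q := fun h => hs (Fin.lt_def.mpr h)
    have hyval : ((finProdFinEquiv (q, y) : Fin (n * 2)) : ℕ) = y + 2 * q := rfl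
    rw [hyval]
    simp only [b, Equiv.symm_apply_apply]
    fin_cases x <;> fin_cases y <;> simp [c] at hij' ⊢ <;> omega
  have hsign : (∏ j : Fin (n * 2), ∏ i ∈ Finset.Iio j, if b i < b j then (1 : SymF) else -1)
      = 1 := by
    refine Finset.prod_eq_one fun j _ => ?_
    by_cases hj : (j : ℕ) % 2 = 1
    · refine Finset.prod_eq_one fun i hi => ?_
      rw [if_pos ((hlt i j (Finset.mem_Iio.mp hi)).mpr hj)]
    · rw [Finset.prod_congr rfl fun i hi =>
        if_neg fun h => hj ((hlt i j (Finset.mem_Iio.mp hi)).mp h)]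
      rw [Finset.prod_const, Fin.card_Iio]
      exact Even.neg_one_pow (Nat.even_iff.mpr (by omega))
  rw [← himg, schur_ptnOfBeads_image hb, hsign, one_mul, Finset.sum_image hs.injective.injOn]
  rw [← Matrix.det_submatrix_equiv_self finProdFinEquiv]
  unfold pairedDet
  have hpow : (-1 : SymF) ^ (∑ r, s r)
      = ∏ p : Fin n × Fin 2, if p.2 = 0 then (-1 : SymF) ^ s p.1 else 1 := by
    rw [Fintype.prod_prod_type, ← Finset.prod_pow_eq_pow_sum]
    simp
  rw [hpow, ← Matrix.det_mul_column]
  congr 1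
  ext1 p q
  have h1 := hL p.1
  have hqval : ((finProdFinEquiv q : Fin (n * 2)) : ℤ) = (2 * q.1 + q.2 : ℕ) := by
    have : ((finProdFinEquiv q : Fin (n * 2)) : ℕ) = q.2 + 2 * q.1 := rfl
    rw [this, add_comm]
  simp only [Matrix.of_apply, Matrix.submatrix_apply, b, Equiv.symm_apply_apply, hqval, c]
  by_cases h : p.2 = 0
  · simp only [if_pos h]
    rw [Nat.cast_sub h1]
  · simp only [if_neg h, one_mul]
    push_cast
    rfl

theorem pleth_det {n : ℕ} (r : ℕ) (M : Matrix (Fin n) (Fin n) SymF) :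
    pleth r M.det = (Matrix.of fun i j => pleth r (M i j)).det := by
  unfold pleth
  rw [AlgHom.map_det]
  rfl

theorem prod_Iio_neg_one (n : ℕ) :
    (∏ j : Fin n, ∏ _i ∈ Finset.Iio j, (-1 : ℤˣ)) = (-1) ^ (n.choose 2) := by
  simp only [Finset.prod_const, Fin.card_Iio]
  rw [Finset.prod_pow_eq_pow_sum, Fin.sum_univ_eq_sum_range (fun i => i), Finset.sum_range_id,
    Nat.choose_two_right]

theorem sign_revPerm (n : ℕ) :
    Equiv.Perm.sign (Fin.revPerm : Equiv.Perm (Fin n)) = (-1) ^ (n.choose 2) := by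
  rw [Equiv.Perm.sign_eq_prod_prod_Iio, ← prod_Iio_neg_one]
  refine Finset.prod_congr rfl fun j _ => Finset.prod_congr rfl fun i hi => ?_
  rw [if_neg]
  have := Finset.mem_Iio.mp hi
  simpa using this.le

theorem pleth_schur_rect (n m : ℕ) :
    pleth 2 (schur (rect n m))
      = (Matrix.of fun i j : Fin n => pleth 2 (hz ((m : ℤ) + j - i))).det := by
  have hrect : rect n m = Ptn.of ((Multiset.range n).map fun i => if i < n then m else 0) := by
    unfold rect
    congr 1
    rw [Multiset.map_congr rfl fun i hi => if_pos (Multiset.mem_range.mp hi)]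
    simp
  rw [hrect, schur_eq_det_of_length_le _ (Ptn.length_of_map_range_le _ n), pleth_det]
  congr 1
  ext1 i j
  simp only [Matrix.of_apply]
  rw [Ptn.part_of_map_range, if_pos i.isLt]
  · intro a b hab
    by_cases hb : b < n
    · simp [hb, hab.trans_lt hb]
    · simp [hb]
  · intro a ha
    exact if_neg (by omega)

theorem det_pleth_hz_antidiagonal {n m L : ℕ} (h : L + 1 = n + m) :
    (Matrix.of fun i k : Fin n => (-1 : SymF) ^ L * pleth 2 (hz ((L : ℤ) - (i : ℕ) - (k : ℕ)))).det
      = (-1) ^ (n * L + n.choose 2) * pleth 2 (schur (rect n m)) := by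
  have hperm := Matrix.det_permute' (Fin.revPerm : Equiv.Perm (Fin n))
    (Matrix.of fun i k : Fin n => pleth 2 (hz ((L : ℤ) - (i : ℕ) - (k : ℕ))))
  have hrev : ((Matrix.of fun i k : Fin n =>
      pleth 2 (hz ((L : ℤ) - (i : ℕ) - (k : ℕ)))).submatrix id Fin.revPerm)
      = Matrix.of fun i j : Fin n => pleth 2 (hz ((m : ℤ) + j - i)) := by
    ext1 i j
    simp only [Matrix.submatrix_apply, Matrix.of_apply, id, Fin.revPerm_apply, Fin.val_rev]
    congr 2
    omega
  rw [hrev, ← pleth_schur_rect, sign_revPerm] at hperm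
  have hsmul : (Matrix.of fun i k : Fin n =>
      (-1 : SymF) ^ L * pleth 2 (hz ((L : ℤ) - (i : ℕ) - (k : ℕ))))
      = (-1 : SymF) ^ L • Matrix.of fun i k : Fin n =>
        pleth 2 (hz ((L : ℤ) - (i : ℕ) - (k : ℕ))) := rfl
  have e3 : (-1 : SymF) ^ (n.choose 2) * (-1) ^ (n.choose 2) = 1 := by rw [← mul_pow]; simp
  rw [hsmul, Matrix.det_smul, Fintype.card_fin, ← pow_mul, mul_comm L, hperm, pow_add]
  push_cast
  linear_combination (-(-1) ^ (n * L) * (Matrix.of fun i k : Fin n =>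
        pleth 2 (hz ((L : ℤ) - (i : ℕ) - (k : ℕ)))).det) * e3

theorem sum_schur_symmBeads {n m L : ℕ} (h : L + 1 = n + m) :
    ∑ S ∈ (Finset.range (L + 1)).powersetCard n,
        (-1 : SymF) ^ (∑ x ∈ S, x) * schur (ptnOfBeads (symmBeads L S))
      = (-1) ^ (n * L + n.choose 2) * pleth 2 (schur (rect n m)) := by
  rw [← det_pleth_hz_antidiagonal h]
  refine sum_powersetCard_pairedDet (Finset.range (L + 1))
    (fun (s : ℕ) p => (-1 : SymF) ^ s * hz ((L : ℤ) - s - (2 * p.1 + p.2 : ℕ)))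
    (fun (s : ℕ) p => hz (((L + 1 : ℕ) : ℤ) + s - (2 * p.1 + p.2 : ℕ))) _ ?_ ?_ ?_ ?_
  · intro i k
    rw [← sub_eq_zero, sum_range_hz_antisymm, sum_range_hz_of_even, mul_zero]
    exact ⟨i + k, by simp; ring⟩
  · intro i k
    rw [← sub_eq_zero, sum_range_hz_antisymm, sum_range_hz_of_even, mul_zero]
    exact ⟨i + k + 1, by simp; ring⟩
  · intro i k
    rw [sum_range_hz_antisymm]
    congr 1
    exact sum_range_hz_of_odd L i k
  · intro s hs hT
    exact pairedDet_symm_eq L s hs fun r => Nat.lt_succ_iff.mp (Finset.mem_range.mp (hT r))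

/-- The partition obtained from `Λ_ℓ` by adding one cell to each row `3 s + 1` with `s ∉ S`. -/
def lamAdd (ℓ : ℕ) (S : Finset ℕ) : Ptn :=
  Ptn.of ((Multiset.range ℓ).map fun s => 3 * s + 1 + if s ∈ S then 0 else 1)

theorem LamP_eq_lamAdd (ℓ : ℕ) : LamP ℓ = lamAdd ℓ (Finset.range ℓ) := by
  unfold LamP lamAdd
  congr 1
  refine Multiset.map_congr rfl fun s hs => ?_
  rw [if_pos (Finset.mem_range.mpr (Multiset.mem_range.mp hs))]

theorem parts_lamAdd (ℓ : ℕ) (S : Finset ℕ) : (lamAdd ℓ S).parts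
    = (Multiset.range ℓ).map fun s => 3 * s + 1 + if s ∈ S then 0 else 1 := by
  unfold lamAdd Ptn.of
  rw [Multiset.filter_eq_self]
  intro x hx
  obtain ⟨s, -, rfl⟩ := Multiset.mem_map.mp hx
  omega

theorem strict_lamAdd (ℓ : ℕ) (S : Finset ℕ) : (lamAdd ℓ S).Strict := by
  unfold Ptn.Strict
  rw [parts_lamAdd]
  refine Multiset.Nodup.map_on (fun x _ y _ h => ?_) (Multiset.nodup_range ℓ)
  split_ifs at h <;> omega

theorem length_lamAdd (ℓ : ℕ) (S : Finset ℕ) : (lamAdd ℓ S).length = ℓ := by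
  unfold Ptn.length
  rw [parts_lamAdd, Multiset.card_map, Multiset.card_range]

theorem three_mul_add_one_mem_lamAdd {ℓ s : ℕ} {S : Finset ℕ} :
    3 * s + 1 ∈ (lamAdd ℓ S).parts ↔ s < ℓ ∧ s ∈ S := by
  rw [parts_lamAdd, Multiset.mem_map]
  constructor
  · rintro ⟨t, ht, h⟩
    have ht := Multiset.mem_range.mp ht
    split_ifs at h with hS
    · have : t = s := by omega
      exact this ▸ ⟨ht, hS⟩
    · omega
  · rintro ⟨h1, h2⟩
    exact ⟨s, Multiset.mem_range.mpr h1, by rw [if_pos h2]⟩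

theorem three_mul_add_two_mem_lamAdd {ℓ s : ℕ} {S : Finset ℕ} :
    3 * s + 2 ∈ (lamAdd ℓ S).parts ↔ s < ℓ ∧ s ∉ S := by
  rw [parts_lamAdd, Multiset.mem_map]
  constructor
  · rintro ⟨t, ht, h⟩
    have ht := Multiset.mem_range.mp ht
    split_ifs at h with hS
    · omega
    · have : t = s := by omega
      exact this ▸ ⟨ht, hS⟩
  · rintro ⟨h1, h2⟩
    exact ⟨s, Multiset.mem_range.mpr h1, by rw [if_neg h2]⟩

theorem Multiset.map_range_reflect {α : Type*} (n : ℕ) (f : ℕ → α) :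
    (Multiset.range n).map (fun i => f (n - 1 - i)) = (Multiset.range n).map f := by
  have h : (Multiset.range n).map (fun i => n - 1 - i) = Multiset.range n := by
    refine (Multiset.Nodup.ext (Multiset.Nodup.map_on (fun x hx y hy h => ?_)
      (Multiset.nodup_range n)) (Multiset.nodup_range n)).mpr fun a => ?_
    · have := Multiset.mem_range.mp hx
      have := Multiset.mem_range.mp hy
      omega
    · simp only [Multiset.mem_map, Multiset.mem_range]
      exact ⟨fun ⟨i, hi, h⟩ => by omega, fun h => ⟨n - 1 - a, by omega, by omega⟩⟩
  conv_rhs => rw [← h, Multiset.map_map]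
  rfl

theorem part_lamAdd (ℓ : ℕ) (S : Finset ℕ) (i : ℕ) : (lamAdd ℓ S).part i
    = if i < ℓ then 3 * (ℓ - 1 - i) + 1 + (if ℓ - 1 - i ∈ S then 0 else 1) else 0 := by
  have h : lamAdd ℓ S = Ptn.of ((Multiset.range ℓ).map fun i => if i < ℓ then
      3 * (ℓ - 1 - i) + 1 + (if ℓ - 1 - i ∈ S then 0 else 1) else 0) := by
    unfold lamAdd
    rw [← Multiset.map_range_reflect]
    congr 1
    exact Multiset.map_congr rfl fun i hi => (if_pos (Multiset.mem_range.mp hi)).symm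
  rw [h, Ptn.part_of_map_range]
  · intro i j hij
    dsimp only
    split_ifs <;> try omega
    all_goals
      have hne : i ≠ j := by rintro rfl; contradiction
      omega
  · exact fun i hi => if_neg (by omega)

theorem part_LamP (ℓ i : ℕ) : (LamP ℓ).part i = if i < ℓ then 3 * (ℓ - 1 - i) + 1 else 0 := by
  rw [LamP_eq_lamAdd, part_lamAdd]
  by_cases h : i < ℓ
  · rw [if_pos h, if_pos h, if_pos (Finset.mem_range.mpr (by omega))]
  · rw [if_neg h, if_neg h]

theorem size_lamAdd {ℓ : ℕ} {S : Finset ℕ} (hS : S ⊆ Finset.range ℓ) :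
    (lamAdd ℓ S).size + S.card = (LamP ℓ).size + ℓ := by
  have h : ∀ T : Finset ℕ, (lamAdd ℓ T).size
      = ∑ s ∈ Finset.range ℓ, (3 * s + 1 + if s ∈ T then 0 else 1) := by
    intro T
    unfold Ptn.size
    rw [parts_lamAdd]
    rfl
  have hcard : S.card = ∑ s ∈ Finset.range ℓ, if s ∈ S then 1 else 0 := by
    rw [← Finset.card_filter, Finset.filter_mem_eq_inter, Finset.inter_eq_right.mpr hS]
  have hl : ∑ _s ∈ Finset.range ℓ, 1 = ℓ := by simp
  rw [LamP_eq_lamAdd, h, h, hcard]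
  refine Eq.trans ?_ (congrArg _ hl)
  rw [← Finset.sum_add_distrib, ← Finset.sum_add_distrib]
  refine Finset.sum_congr rfl fun s hs => ?_
  rw [if_pos hs]
  split_ifs <;> rfl

theorem lamAdd_injOn (ℓ n : ℕ) :
    Set.InjOn (lamAdd ℓ) ((Finset.range ℓ).powersetCard n : Finset (Finset ℕ)) := by
  intro S hS T hT h
  have hS := (Finset.mem_powersetCard.mp hS).1
  have hT := (Finset.mem_powersetCard.mp hT).1
  ext s
  have h1 := three_mul_add_one_mem_lamAdd (ℓ := ℓ) (s := s) (S := S)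
  rw [h, three_mul_add_one_mem_lamAdd] at h1
  constructor
  · intro hs
    exact (h1.mpr ⟨Finset.mem_range.mp (hS hs), hs⟩).2
  · intro hs
    exact (h1.mp ⟨Finset.mem_range.mp (hT hs), hs⟩).2

theorem F1Lam_eq_image {ℓ m : ℕ} (hm : m ≤ ℓ) : F1Lam ℓ m
    = Set.image (lamAdd ℓ) ((Finset.range ℓ).powersetCard (ℓ - m) : Finset (Finset ℕ)) := by
  ext mu
  constructor
  · rintro ⟨-, hcont, hsize, hcell⟩
    let S := (Finset.range ℓ).filter fun s => mu.part (ℓ - 1 - s) = 3 * s + 1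
    have hS : S ⊆ Finset.range ℓ := Finset.filter_subset _ _
    have hmu : lamAdd ℓ S = mu := by
      refine Ptn.ext_part fun i => ?_
      have h1 := hcont i
      have h2 := hcell i
      rw [part_LamP] at h1 h2
      rw [part_lamAdd]
      by_cases hi : i < ℓ
      · rw [if_pos hi] at h1 h2 ⊢
        have e : ℓ - 1 - (ℓ - 1 - i) = i := by omega
        have hmem : ℓ - 1 - i ∈ S ↔ mu.part i = 3 * (ℓ - 1 - i) + 1 := by
          simp only [S, Finset.mem_filter, Finset.mem_range, e]
          exact and_iff_right (by omega)
        have h3 := h2 (3 * (ℓ - 1 - i) + 2) (by omega)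
        by_cases h : ℓ - 1 - i ∈ S
        · rw [if_pos h, hmem.mp h]
        · rw [if_neg h]
          have hne : mu.part i ≠ 3 * (ℓ - 1 - i) + 1 := fun h' => h (hmem.mpr h')
          omega
      · rw [if_neg hi] at h2 ⊢
        have h3 := h2 0 le_rfl
        omega
    refine ⟨S, Finset.mem_coe.mpr (Finset.mem_powersetCard.mpr ⟨hS, ?_⟩), hmu⟩
    have := size_lamAdd hS
    rw [hmu] at this
    omega
  · rintro ⟨S, hS, rfl⟩
    obtain ⟨hS, hcard⟩ := Finset.mem_powersetCard.mp (Finset.mem_coe.mp hS)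
    refine ⟨strict_lamAdd ℓ S, fun i => ?_, ?_, fun i j h1 h2 => ?_⟩
    · rw [part_LamP, part_lamAdd]
      split_ifs <;> omega
    · have := size_lamAdd hS
      omega
    · rw [part_LamP] at h1
      rw [part_lamAdd] at h2
      split_ifs at h1 h2 <;> omega

theorem barQuot1_lamAdd {L : ℕ} {S : Finset ℕ} (hS : S ⊆ Finset.range (L + 1)) :
    barQuot1 (lamAdd (L + 1) S) = ptnOfBeads (symmBeads L S) := by
  have hD := length_le_length_double (strict_lamAdd (L + 1) S)
  rw [length_lamAdd] at hD
  unfold barQuot1 quotP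
  rw [← ptnOfBeads_range_union_map ((double (lamAdd (L + 1) S)).length - (L + 1)) (symmBeads L S)]
  congr 1
  ext s
  rw [mem_runnerLevels_double (strict_lamAdd (L + 1) S), three_mul_add_one_mem_lamAdd,
    three_mul_add_two_mem_lamAdd]
  generalize (double (lamAdd (L + 1) S)).length = D at hD
  simp only [symmBeads, Finset.mem_union, Finset.mem_range, Finset.mem_map, Finset.mem_image,
    addRightEmbedding_apply]
  constructor
  · rintro (⟨h1, -, h2⟩ | ⟨h1, h2⟩)
    · exact Or.inr ⟨L + 1 + (s - D), Or.inr ⟨s - D, h2, rfl⟩, by omega⟩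
    · by_cases h : D - 1 - s ∈ S
      · have := Finset.mem_range.mp (hS h)
        exact Or.inr ⟨L - (D - 1 - s), Or.inl ⟨_, h, rfl⟩, by omega⟩
      · left
        by_contra h'
        exact h2 ⟨by omega, h⟩
  · rintro (h | ⟨x, ⟨t, ht, rfl⟩ | ⟨t, ht, rfl⟩, rfl⟩)
    · exact Or.inr ⟨by omega, fun h' => by omega⟩
    · have := Finset.mem_range.mp (hS ht)
      refine Or.inr ⟨by omega, fun h' => h'.2 ?_⟩
      have e : D - 1 - (L - t + (D - (L + 1))) = t := by omega
      rwa [e]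
    · have := Finset.mem_range.mp (hS ht)
      have e : L + 1 + t + (D - (L + 1)) - D = t := by omega
      exact Or.inl ⟨by omega, by rw [e]; exact ⟨this, ht⟩⟩

/-- The number of elements of `S` below `t`. -/
def rankIn (S : Finset ℕ) (t : ℕ) : ℕ := (S.filter fun q => q < t).card

theorem rankIn_lt_card {S : Finset ℕ} {t : ℕ} (ht : t ∈ S) : rankIn S t < S.card :=
  Finset.card_lt_card (Finset.filter_ssubset.mpr ⟨t, ht, lt_irrefl t⟩)

theorem rankIn_mono (S : Finset ℕ) : Monotone (rankIn S) := fun _ _ h =>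
  Finset.card_le_card (Finset.monotone_filter_right _ fun _ _ hq => lt_of_lt_of_le hq h)

theorem sum_rankIn {M : Type*} [AddCommMonoid M] (S : Finset ℕ) (f : ℕ → M) :
    ∑ t ∈ S, f (rankIn S t) = ∑ i ∈ Finset.range S.card, f i := by
  induction S using Finset.induction_on_max with
  | empty => simp
  | insert a S ha ih =>
    have hmem : a ∉ S := fun h => lt_irrefl _ (ha a h)
    have h1 : rankIn (insert a S) a = S.card := by
      unfold rankIn
      rw [Finset.filter_insert, if_neg (lt_irrefl a), Finset.filter_true_of_mem ha]
    have h2 : ∀ t ∈ S, rankIn (insert a S) t = rankIn S t := by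
      intro t ht
      unfold rankIn
      rw [Finset.filter_insert, if_neg (not_lt.mpr (ha t ht).le)]
    rw [Finset.sum_insert hmem, h1, Finset.sum_congr rfl fun t ht => congrArg f (h2 t ht), ih,
      Finset.card_insert_of_notMem hmem, Finset.sum_range_succ, add_comm]

theorem card_filter_rankIn_lt (S : Finset ℕ) (c : ℕ) :
    (S.filter fun t => rankIn S t < c).card = min c S.card := by
  rw [Finset.card_filter, sum_rankIn S fun i => if i < c then 1 else 0, ← Finset.card_filter]
  have : (Finset.range S.card).filter (fun i => i < c) = Finset.range (min c S.card) := by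
    ext i
    simp only [Finset.mem_filter, Finset.mem_range]
    omega
  rw [this, Finset.card_range]

/-- The beads on runners `1` and `2` with level sets `S` and `T`. -/
def runnerBeads (S T : Finset ℕ) : Finset ℕ :=
  S.image (fun s => 3 * s + 1) ∪ T.image (fun s => 3 * s + 2)

theorem mem_runnerBeads {S T : Finset ℕ} {x : ℕ} :
    x ∈ runnerBeads S T ↔ (∃ s ∈ S, 3 * s + 1 = x) ∨ ∃ s ∈ T, 3 * s + 2 = x := by
  simp [runnerBeads]

theorem card_filter_runnerBeads_one {S T : Finset ℕ} (P : ℕ → Prop) [DecidablePred P] :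
    ((runnerBeads S T).filter fun q => q % 3 = 1 ∧ P q).card
      = (S.filter fun s => P (3 * s + 1)).card := by
  rw [← Finset.card_image_of_injective (S.filter fun s => P (3 * s + 1))
    (f := fun s => 3 * s + 1) fun a b h => by simpa using h]
  congr 1
  ext x
  simp only [Finset.mem_filter, mem_runnerBeads, Finset.mem_image]
  constructor
  · rintro ⟨⟨s, hs, rfl⟩ | ⟨s, hs, rfl⟩, h, hP⟩
    · exact ⟨s, ⟨hs, hP⟩, rfl⟩
    · omega
  · rintro ⟨s, ⟨hs, hP⟩, rfl⟩
    exact ⟨Or.inl ⟨s, hs, rfl⟩, by omega, hP⟩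

theorem card_filter_runnerBeads_two {S T : Finset ℕ} (P : ℕ → Prop) [DecidablePred P] :
    ((runnerBeads S T).filter fun q => q % 3 = 2 ∧ P q).card
      = (T.filter fun s => P (3 * s + 2)).card := by
  rw [← Finset.card_image_of_injective (T.filter fun s => P (3 * s + 2))
    (f := fun s => 3 * s + 2) fun a b h => by simpa using h]
  congr 1
  ext x
  simp only [Finset.mem_filter, mem_runnerBeads, Finset.mem_image]
  constructor
  · rintro ⟨⟨s, hs, rfl⟩ | ⟨s, hs, rfl⟩, h, hP⟩
    · omega
    · exact ⟨s, ⟨hs, hP⟩, rfl⟩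
  · rintro ⟨s, ⟨hs, hP⟩, rfl⟩
    exact ⟨Or.inr ⟨s, hs, rfl⟩, by omega, hP⟩

theorem card_filter_runnerBeads_mod (S T : Finset ℕ) :
    ((runnerBeads S T).filter fun q => q % 3 = 0).card = 0 ∧
    ((runnerBeads S T).filter fun q => q % 3 = 1).card = S.card ∧
    ((runnerBeads S T).filter fun q => q % 3 = 2).card = T.card := by
  refine ⟨?_, ?_, ?_⟩
  · rw [Finset.card_eq_zero, Finset.filter_eq_empty_iff]
    intro x hx
    rcases mem_runnerBeads.mp hx with ⟨s, -, rfl⟩ | ⟨s, -, rfl⟩ <;> omega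
  · simpa using card_filter_runnerBeads_one (S := S) (T := T) fun _ => True
  · simpa using card_filter_runnerBeads_two (S := S) (T := T) fun _ => True

theorem barKey_runnerBeads_one (S T : Finset ℕ) (s : ℕ) :
    barKey (runnerBeads S T) (3 * s + 1) = if rankIn S s < min S.card T.card
      then 2 * rankIn S s + 1 else min S.card T.card + rankIn S s := by
  obtain ⟨h0, h1, h2⟩ := card_filter_runnerBeads_mod S T
  have hm : (3 * s + 1) % 3 = 1 := by omega
  have hr : ((runnerBeads S T).filter fun q => q % 3 = 1 ∧ q < 3 * s + 1).card = rankIn S s := by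
    rw [card_filter_runnerBeads_one fun q => q < 3 * s + 1]
    unfold rankIn
    congr 2
    ext q
    omega
  unfold barKey
  simp only [h0, h1, h2, hm, hr, OfNat.one_ne_ofNat, one_ne_zero, if_false]
  split_ifs <;> omega

theorem barKey_runnerBeads_two (S T : Finset ℕ) (s : ℕ) :
    barKey (runnerBeads S T) (3 * s + 2) = if rankIn T s < min S.card T.card
      then 2 * rankIn T s else min S.card T.card + rankIn T s := by
  obtain ⟨h0, h1, h2⟩ := card_filter_runnerBeads_mod S T
  have hm : (3 * s + 2) % 3 = 2 := by omega
  have hr : ((runnerBeads S T).filter fun q => q % 3 = 2 ∧ q < 3 * s + 2).card = rankIn T s := by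
    rw [card_filter_runnerBeads_two fun q => q < 3 * s + 2]
    unfold rankIn
    congr 2
    ext q
    omega
  unfold barKey
  simp only [h0, h1, h2, hm, hr, OfNat.ofNat_ne_zero, if_true, if_false]
  split_ifs <;> omega

theorem barKey_two_lt_one {S T : Finset ℕ} {s t : ℕ} (hs : s ∈ T) (ht : t ∈ S) :
    barKey (runnerBeads S T) (3 * s + 2) < barKey (runnerBeads S T) (3 * t + 1)
      ↔ rankIn T s ≤ rankIn S t := by
  rw [barKey_runnerBeads_one, barKey_runnerBeads_two]
  have h1 := rankIn_lt_card hs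
  have h2 := rankIn_lt_card ht
  split_ifs <;> omega

theorem barKey_one_lt_two {S T : Finset ℕ} {s t : ℕ} (hs : s ∈ T) (ht : t ∈ S) :
    barKey (runnerBeads S T) (3 * t + 1) < barKey (runnerBeads S T) (3 * s + 2)
      ↔ rankIn S t < rankIn T s := by
  rw [barKey_runnerBeads_one, barKey_runnerBeads_two]
  have h1 := rankIn_lt_card hs
  have h2 := rankIn_lt_card ht
  split_ifs <;> omega

theorem barKey_one_mono {S T : Finset ℕ} {s t : ℕ} (h : s ≤ t) :
    barKey (runnerBeads S T) (3 * s + 1) ≤ barKey (runnerBeads S T) (3 * t + 1) := by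
  rw [barKey_runnerBeads_one, barKey_runnerBeads_one]
  have := rankIn_mono S h
  split_ifs <;> omega

theorem barKey_two_mono {S T : Finset ℕ} {s t : ℕ} (h : s ≤ t) :
    barKey (runnerBeads S T) (3 * s + 2) ≤ barKey (runnerBeads S T) (3 * t + 2) := by
  rw [barKey_runnerBeads_two, barKey_runnerBeads_two]
  have := rankIn_mono T h
  split_ifs <;> omega

theorem inversions_barKey_runnerBeads {S T : Finset ℕ} (hST : Disjoint S T) :
    inversions (barKey (runnerBeads S T)) (runnerBeads S T)
      = ∑ s ∈ T, (S.filter fun t => ¬(t < s ↔ rankIn S t < rankIn T s)).card := by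
  have hsum : ∑ s ∈ T, (S.filter fun t => ¬(t < s ↔ rankIn S t < rankIn T s)).card
      = ((T ×ˢ S).filter fun p => ¬(p.2 < p.1 ↔ rankIn S p.2 < rankIn T p.1)).card := by
    simp_rw [Finset.card_filter]
    rw [Finset.sum_product]
  rw [hsum]
  unfold inversions
  symm
  refine Finset.card_bij (fun p _ => if p.2 < p.1 then (3 * p.2 + 1, 3 * p.1 + 2)
    else (3 * p.1 + 2, 3 * p.2 + 1)) ?_ ?_ ?_
  · rintro ⟨s, t⟩ hp
    obtain ⟨hp, hiff⟩ := Finset.mem_filter.mp hp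
    obtain ⟨hs, ht⟩ := Finset.mem_product.mp hp
    have hs' : 3 * s + 2 ∈ runnerBeads S T := mem_runnerBeads.mpr (Or.inr ⟨s, hs, rfl⟩)
    have ht' : 3 * t + 1 ∈ runnerBeads S T := mem_runnerBeads.mpr (Or.inl ⟨t, ht, rfl⟩)
    have hne : t ≠ s := fun h => Finset.disjoint_left.mp hST ht (h ▸ hs)
    dsimp only at hs ht hiff ⊢
    split_ifs with h
    · refine Finset.mem_filter.mpr ⟨Finset.mk_mem_product ht' hs', by dsimp only; omega, ?_⟩
      exact (barKey_two_lt_one hs ht).mpr (by omega)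
    · refine Finset.mem_filter.mpr ⟨Finset.mk_mem_product hs' ht', by dsimp only; omega, ?_⟩
      exact (barKey_one_lt_two hs ht).mpr (by omega)
  · rintro ⟨s, t⟩ _ ⟨s', t'⟩ _ h
    dsimp only at h
    split_ifs at h <;> simp only [Prod.mk.injEq] at h ⊢ <;> omega
  · rintro ⟨x, y⟩ hxy
    obtain ⟨hxy, hlt, hkey⟩ := Finset.mem_filter.mp hxy
    obtain ⟨hx, hy⟩ := Finset.mem_product.mp hxy
    dsimp only at hx hy hlt hkey
    rcases mem_runnerBeads.mp hx with ⟨s, hs, rfl⟩ | ⟨s, hs, rfl⟩ <;>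
      rcases mem_runnerBeads.mp hy with ⟨t, ht, rfl⟩ | ⟨t, ht, rfl⟩
    · exact absurd hkey (not_lt.mpr (barKey_one_mono (by omega)))
    · have hne : s ≠ t := fun h => Finset.disjoint_left.mp hST hs (h ▸ ht)
      have h1 := (barKey_two_lt_one ht hs).mp hkey
      have h2 : s < t := by omega
      refine ⟨(t, s), Finset.mem_filter.mpr ⟨Finset.mk_mem_product ht hs, ?_⟩, ?_⟩
      · dsimp only
        omega
      · simp [h2]
    · have h1 := (barKey_one_lt_two hs ht).mp hkey
      have h2 : ¬ t < s := by omega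
      refine ⟨(s, t), Finset.mem_filter.mpr ⟨Finset.mk_mem_product hs ht, ?_⟩, ?_⟩
      · dsimp only
        omega
      · simp [h2]
    · exact absurd hkey (not_lt.mpr (barKey_two_mono (by omega)))

theorem neg_one_pow_card_filter_not_iff {α : Type*} (S : Finset α) (P Q : α → Prop)
    [DecidablePred P] [DecidablePred Q] :
    (-1 : ℤ) ^ (S.filter fun t => ¬(P t ↔ Q t)).card
      = (-1) ^ ((S.filter P).card + (S.filter Q).card) := by
  rw [Finset.card_filter, Finset.card_filter, Finset.card_filter, ← Finset.sum_add_distrib,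
    ← Finset.prod_pow_eq_pow_sum, ← Finset.prod_pow_eq_pow_sum]
  refine Finset.prod_congr rfl fun t _ => ?_
  by_cases hP : P t <;> by_cases hQ : Q t <;> simp [hP, hQ]

theorem rankIn_add_rankIn_sdiff {ℓ s : ℕ} {S : Finset ℕ} (hs : s < ℓ) :
    rankIn (S ∩ Finset.range ℓ) s + rankIn (Finset.range ℓ \ S) s = s := by
  unfold rankIn
  rw [← Finset.card_union_of_disjoint]
  · have : (S ∩ Finset.range ℓ).filter (fun q => q < s)
        ∪ (Finset.range ℓ \ S).filter (fun q => q < s) = Finset.range s := by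
      ext q
      simp only [Finset.mem_union, Finset.mem_filter, Finset.mem_inter, Finset.mem_sdiff,
        Finset.mem_range]
      by_cases hq : q ∈ S <;> simp [hq] <;> omega
    rw [this, Finset.card_range]
  · refine Finset.disjoint_left.mpr fun q h1 h2 => ?_
    simp only [Finset.mem_filter, Finset.mem_inter, Finset.mem_sdiff] at h1 h2
    exact h2.1.2 h1.1.1

theorem barSign3_lamAdd {ℓ n m : ℕ} {S : Finset ℕ} (hS : S ⊆ Finset.range ℓ) (hn : S.card = n)
    (hl : ℓ = n + m) :
    barSign3 (lamAdd ℓ S) = (-1) ^ (∑ s ∈ Finset.range ℓ \ S, s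
      + ∑ j ∈ Finset.range m, (j + min j n)) := by
  have hcard : (Finset.range ℓ \ S).card = m := by
    rw [Finset.card_sdiff_of_subset hS, Finset.card_range]
    omega
  have hbeads : (lamAdd ℓ S).parts.toFinset = runnerBeads S (Finset.range ℓ \ S) := by
    ext x
    rw [Multiset.mem_toFinset, mem_runnerBeads]
    constructor
    · rw [parts_lamAdd]
      intro hx
      obtain ⟨s, hs, rfl⟩ := Multiset.mem_map.mp hx
      have hs := Multiset.mem_range.mp hs
      by_cases h : s ∈ S
      · exact Or.inl ⟨s, h, by rw [if_pos h]⟩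
      · exact Or.inr ⟨s, Finset.mem_sdiff.mpr ⟨Finset.mem_range.mpr hs, h⟩, by rw [if_neg h]⟩
    · rintro (⟨s, hs, rfl⟩ | ⟨s, hs, rfl⟩)
      · exact three_mul_add_one_mem_lamAdd.mpr ⟨Finset.mem_range.mp (hS hs), hs⟩
      · have := Finset.mem_sdiff.mp hs
        exact three_mul_add_two_mem_lamAdd.mpr ⟨Finset.mem_range.mp this.1, this.2⟩
  unfold barSign3 barSignExp
  rw [hbeads, inversions_barKey_runnerBeads Finset.disjoint_sdiff, ← Finset.prod_pow_eq_pow_sum]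
  have hterm : ∀ s ∈ Finset.range ℓ \ S,
      (-1 : ℤ) ^ (S.filter fun t => ¬(t < s ↔ rankIn S t < rankIn (Finset.range ℓ \ S) s)).card
        = (-1) ^ (s + (rankIn (Finset.range ℓ \ S) s + min (rankIn (Finset.range ℓ \ S) s) n)) := by
    intro s hs
    have hs := Finset.mem_range.mp (Finset.mem_sdiff.mp hs).1
    have hrank := rankIn_add_rankIn_sdiff (S := S) hs
    rw [Finset.inter_eq_left.mpr hS] at hrank
    rw [neg_one_pow_card_filter_not_iff, card_filter_rankIn_lt, hn]
    change (-1 : ℤ) ^ (rankIn S s + _) = _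
    generalize rankIn (Finset.range ℓ \ S) s = c at hrank ⊢
    have e : s + (c + min c n) = (rankIn S s + min c n) + (c + c) := by omega
    rw [e, pow_add _ _ (c + c), Even.neg_one_pow ⟨c, rfl⟩, mul_one]
  rw [Finset.prod_congr rfl hterm, Finset.prod_pow_eq_pow_sum, Finset.sum_add_distrib,
    sum_rankIn (Finset.range ℓ \ S) fun j => j + min j n, hcard]

theorem Nat.choose_two_add (a b : ℕ) :
    (a + b).choose 2 = a.choose 2 + b.choose 2 + a * b := by
  induction b with
  | zero => simp
  | succ b ih =>
    rw [← add_assoc, Nat.choose_succ_succ' (a + b), Nat.choose_succ_succ' b, ih,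
      Nat.choose_one_right, Nat.choose_one_right]
    ring

theorem finsum_F1Lam {L n m : ℕ} (h : L + 1 = n + m) :
    ∑ᶠ μ ∈ F1Lam (L + 1) m, barSign3 μ • schur (barQuot1 μ)
      = ((-1 : ℤ) ^ ((L + 1).choose 2 + ∑ j ∈ Finset.range m, (j + min j n)
          + (n * L + n.choose 2))) • pleth 2 (schur (rect n m)) := by
  have hn : L + 1 - m = n := by omega
  rw [F1Lam_eq_image (by omega), hn, finsum_mem_image (lamAdd_injOn (L + 1) n),
    finsum_mem_coe_finset, pow_add, mul_smul, zsmul_eq_mul (pleth 2 _)]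
  push_cast
  rw [← sum_schur_symmBeads h, Finset.smul_sum]
  refine Finset.sum_congr rfl fun S hS => ?_
  obtain ⟨hS, hcard⟩ := Finset.mem_powersetCard.mp hS
  have hsum : (L + 1).choose 2 = ∑ s ∈ Finset.range (L + 1) \ S, s + ∑ s ∈ S, s := by
    rw [Finset.sum_sdiff hS, Finset.sum_range_id, Nat.choose_two_right]
  have e3 : (-1 : SymF) ^ (∑ s ∈ S, s) * (-1) ^ (∑ s ∈ S, s) = 1 := by rw [← mul_pow]; simp
  rw [barQuot1_lamAdd hS, barSign3_lamAdd hS hcard h, hsum, zsmul_eq_mul, zsmul_eq_mul]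
  push_cast
  simp only [pow_add]
  linear_combination (-(-1) ^ (∑ s ∈ Finset.range (L + 1) \ S, s) *
    (-1) ^ (∑ j ∈ Finset.range m, (j + min j n)) * schur (ptnOfBeads (symmBeads L S))) * e3

theorem neg_one_pow_eq_of_even_add {a b : ℕ} (h : Even (a + b)) : (-1 : ℤ) ^ a = (-1) ^ b :=
  neg_one_pow_congr (Nat.even_add.mp h)

theorem sum_range_add_min_of_le {m n : ℕ} (h : m ≤ n) :
    ∑ j ∈ Finset.range m, (j + min j n) = 2 * m.choose 2 := by
  rw [Nat.choose_two_right, ← Finset.sum_range_id, Finset.mul_sum]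
  refine Finset.sum_congr rfl fun j hj => ?_
  have := Finset.mem_range.mp hj
  omega

theorem sum_range_add_min_add (n d : ℕ) :
    ∑ j ∈ Finset.range (n + d), (j + min j n) = 2 * n.choose 2 + (2 * (n * d) + d.choose 2) := by
  rw [Finset.sum_range_add, sum_range_add_min_of_le le_rfl]
  have : ∀ i ∈ Finset.range d, n + i + min (n + i) n = 2 * n + i := by
    intro i _
    omega
  rw [Finset.sum_congr rfl this, Finset.sum_add_distrib, Finset.sum_range_id,
    ← Nat.choose_two_right, Finset.sum_const, Finset.card_range, smul_eq_mul]
  ring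

theorem sign_exponent_of_le {L n m : ℕ} (h : L + 1 = n + m) (hmn : m ≤ n) :
    (-1 : ℤ) ^ ((L + 1).choose 2 + ∑ j ∈ Finset.range m, (j + min j n) + (n * L + n.choose 2))
      = (-1) ^ m.choose 2 := by
  apply neg_one_pow_eq_of_even_add
  have e1 : n * L + n = n * n + n * m := by rw [← mul_add, ← h]; ring
  obtain ⟨q, hq⟩ : Even (n * n + n) := by
    rw [← Nat.mul_succ]
    exact Nat.even_mul_succ_self n
  rw [sum_range_add_min_of_le hmn, h, Nat.choose_two_add, Nat.even_iff]
  omega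

theorem sign_exponent_of_ge {L n m : ℕ} (h : L + 1 = n + m) (hmn : n ≤ m) :
    (-1 : ℤ) ^ ((L + 1).choose 2 + ∑ j ∈ Finset.range m, (j + min j n) + (n * L + n.choose 2))
      = (-1) ^ ((n + 1).choose 2 + n * m) := by
  apply neg_one_pow_eq_of_even_add
  obtain ⟨d, rfl⟩ := Nat.exists_eq_add_of_le hmn
  have e1 : n * L + n = n * n + n * (n + d) := by rw [← mul_add, ← h]; ring
  have e2 : n * (n + d) = n * n + n * d := mul_add n n d
  obtain ⟨q, hq⟩ : Even (n * n + n) := by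
    rw [← Nat.mul_succ]
    exact Nat.even_mul_succ_self n
  have e4 : Nat.choose 1 2 = 0 := rfl
  rw [sum_range_add_min_add, h, Nat.choose_two_add n (n + d), Nat.choose_two_add n d,
    Nat.choose_two_add n 1, Nat.even_iff]
  omega

/-- Theorem 6.1 (main theorem): for `ℓ ≥ 1` and `0 ≤ m ≤ ℓ`,
`Σ_{μ ∈ F_1^m(Λ_ℓ)} δ̄_3(μ) S_{μ^b[1]} = ε(ℓ,m) · (p_2 ∘ S_{□(ℓ-m,m)})` where
`ε(ℓ,m) = (-1)^{C(m,2)}` for `0 ≤ m ≤ ℓ/2` and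
`ε(ℓ,m) = (-1)^{C(ℓ-m+1,2)+(ℓ-m)m}` for `ℓ/2 ≤ m ≤ ℓ`. -/
theorem stmt0 (ℓ m : ℕ) (hℓ : 1 ≤ ℓ) (hm : m ≤ ℓ) :
    (2 * m ≤ ℓ →
      ∑ᶠ μ ∈ F1Lam ℓ m, barSign3 μ • schur (barQuot1 μ)
        = ((-1 : ℤ) ^ Nat.choose m 2) • pleth 2 (schur (rect (ℓ - m) m))) ∧
    (ℓ ≤ 2 * m →
      ∑ᶠ μ ∈ F1Lam ℓ m, barSign3 μ • schur (barQuot1 μ)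
        = ((-1 : ℤ) ^ (Nat.choose (ℓ - m + 1) 2 + (ℓ - m) * m)) •
            pleth 2 (schur (rect (ℓ - m) m))) := by
  obtain ⟨L, rfl⟩ := Nat.exists_eq_add_of_le' hℓ
  have h : L + 1 = (L + 1 - m) + m := by omega
  refine ⟨fun hle => ?_, fun hge => ?_⟩
  · rw [finsum_F1Lam h, sign_exponent_of_le h (by omega)]
  · rw [finsum_F1Lam h, sign_exponent_of_ge h (by omega)]
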